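/- arXiv:1008.3944 — 2 statements merged into one kernel-verified Lean document; each statement's English description precedes it below -/
import Mathlib

section
/- For every dimension d ≥ 4 there exist convex bodies K ⊆ L ⊆ ℝ^d such that E(V_K) > E(V_L), i.e., the expected volume of the convex hull of d+1 independent uniformly random points is strictly larger for the smaller body K than for the larger body L. -/
open MeasureTheory

/-- A convex body in `ℝ^d`: a compact convex set with nonempty interior. -/
def IsConvexBody {d : ℕ} (K : Set (EuclideanSpace ℝ (Fin d))) : Prop :=
  IsCompact K ∧ Convex ℝ K ∧ (interior K).Nonempty

/-- `E(V_K)`: the expected volume of the convex hull of `d+1` independent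
uniformly random points in `K`. -/
noncomputable def expVolSimplex (d : ℕ) (K : Set (EuclideanSpace ℝ (Fin d))) : ℝ :=
  ⨍ X : Fin (d + 1) → EuclideanSpace ℝ (Fin d) in Set.univ.pi (fun _ => K),
    (volume (convexHull ℝ (Set.range X))).toReal

namespace SimplexVolume

open scoped Pointwise Topology

/-- Points of `ℝᵐ⁺¹`, with the first coordinate split off. -/
abbrev Pt (m : ℕ) : Type := ℝ × (Fin m → ℝ)

/-- Homogeneous coordinates of a point. -/
def homog {m : ℕ} (x : Pt m) : Fin (m + 2) → ℝ := Fin.cons 1 (Fin.cons x.1 x.2)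

/-- The signed volume, up to a factorial, of the simplex with vertices `X`. -/
def simplexDet {m : ℕ} (X : Fin (m + 2) → Pt m) : ℝ :=
  (Matrix.of fun i => homog (X i)).det

/-- The signed volume, up to a factorial, of the simplex with vertices `Y` and the origin. -/
def coneDet {m : ℕ} (Y : Fin (m + 1) → Pt m) : ℝ :=
  (Matrix.of fun i => (Fin.cons (Y i).1 (Y i).2 : Fin (m + 1) → ℝ)).det

/-- The signed volume, up to a factorial, of the projection of a facet to the base. -/
def baseDet {m : ℕ} (z : Fin (m + 1) → Fin m → ℝ) : ℝ :=
  (Matrix.of fun i => (Fin.cons 1 (z i) : Fin (m + 1) → ℝ)).det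

variable {m : ℕ}

lemma simplexDet_cons_zero (Y : Fin (m + 1) → Pt m) :
    simplexDet (Fin.cons 0 Y : Fin (m + 2) → Pt m) = coneDet Y := by
  unfold simplexDet coneDet
  rw [Matrix.det_succ_row_zero, Fin.sum_univ_succ, Finset.sum_eq_zero]
  · simp [homog]
    rfl
  · intro i _
    refine Fin.cases ?_ (fun j => ?_) i <;> simp [homog]

lemma simplexDet_sub_affine (X : Fin (m + 2) → Pt m) (a : ℝ) (b : Fin m → ℝ) :
    simplexDet (fun i => ((X i).1 - (a + b ⬝ᵥ (X i).2), (X i).2)) = simplexDet X := by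
  have h := Matrix.det_updateCol_sum (Matrix.of fun i => homog (X i)) 1
    (Fin.cons (-a) (Fin.cons 1 (-b)))
  have h1 : (Fin.cons (-a) (Fin.cons 1 (-b)) : Fin (m + 2) → ℝ) 1 = 1 := rfl
  rw [h1, one_smul] at h
  unfold simplexDet
  rw [← h]
  congr 1
  ext i j
  refine Fin.cases ?_ (fun j => ?_) j
  · simp [homog]
  · refine Fin.cases ?_ (fun j => ?_) j
    · simp [homog, Fin.sum_univ_succ, dotProduct]
      ring
    · have : (j.succ.succ : Fin (m + 2)) ≠ 1 := by
        intro h; exact absurd (Fin.succ_injective _ h) (Fin.succ_ne_zero j)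
      simp [homog, this]

lemma abs_simplexDet_cons_zero_height (r : ℝ) (w : Fin m → ℝ) (z : Fin (m + 1) → Fin m → ℝ) :
    |simplexDet (Fin.cons (r, w) (fun i => (0, z i)) : Fin (m + 2) → Pt m)|
      = |r| * |baseDet z| := by
  unfold simplexDet baseDet
  rw [Matrix.det_succ_column _ 1, Fin.sum_univ_succ, Finset.sum_eq_zero]
  · simp only [add_zero, abs_mul, abs_pow, abs_neg, abs_one, one_pow, one_mul]
    congr 2
    congr 1
    ext i j
    refine Fin.cases ?_ (fun j => ?_) j
    · simp [homog]
    · have : (1 : Fin (m + 2)).succAbove j.succ = j.succ.succ := by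
        rw [← Fin.succ_zero_eq_one, Fin.succ_succAbove_succ]; simp
      simp [homog, this]
  · intro i _
    have : homog ((0 : ℝ), z i) 1 = 0 := rfl
    simp [this]

/-- If all vertices but one lie on the graph of an affine function, the determinant factors. -/
lemma abs_simplexDet_cons_graph (y : Pt m) (a : ℝ) (b : Fin m → ℝ) (z : Fin (m + 1) → Fin m → ℝ) :
    |simplexDet (Fin.cons y (fun i => (a + b ⬝ᵥ z i, z i)) : Fin (m + 2) → Pt m)|
      = |y.1 - (a + b ⬝ᵥ y.2)| * |baseDet z| := by
  rw [← simplexDet_sub_affine _ a b, ← abs_simplexDet_cons_zero_height _ y.2]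
  congr 2
  ext i : 1
  refine Fin.cases ?_ (fun j => ?_) i <;> simp

lemma simplexDet_perm (X : Fin (m + 2) → Pt m) (σ : Equiv.Perm (Fin (m + 2))) :
    |simplexDet (X ∘ σ)| = |simplexDet X| := by
  have h := Matrix.det_permute σ (Matrix.of fun i => homog (X i))
  have h2 : simplexDet (X ∘ σ) =
    ((Matrix.of fun i => homog (X i)).submatrix σ id).det := rfl
  rw [h2, h, abs_mul]
  rcases Int.units_eq_one_or (Equiv.Perm.sign σ) with h | h <;> simp [h, simplexDet]

lemma abs_simplexDet_insertNth (i : Fin (m + 2)) (y : Pt m) (Y : Fin (m + 1) → Pt m) :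
    |simplexDet (i.insertNth y Y : Fin (m + 2) → Pt m)|
      = |simplexDet (Fin.cons y Y : Fin (m + 2) → Pt m)| := by
  rw [← Fin.cons_comp_cycleRange, simplexDet_perm]

lemma simplexDet_smul_height (s : ℝ) (X : Fin (m + 2) → Pt m) :
    simplexDet (fun i => (s * (X i).1, (X i).2)) = s * simplexDet X := by
  have h := Matrix.det_mul_row (Fin.cons 1 (Fin.cons s fun _ => 1))
    (Matrix.of fun i => homog (X i))
  rw [Fin.prod_univ_succ, Fin.prod_univ_succ] at h
  simp only [Fin.cons_zero, Fin.cons_succ, Finset.prod_const_one, one_mul, mul_one] at h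
  unfold simplexDet
  rw [← h]
  congr 1
  ext i j
  refine Fin.cases ?_ (fun j => ?_) j
  · simp [homog]
  · refine Fin.cases ?_ (fun j => ?_) j <;> simp [homog]

lemma simplexDet_add_height (f : (Fin m → ℝ) → ℝ) (X : Fin (m + 2) → Pt m) :
    simplexDet (fun i => ((X i).1 + f (X i).2, (X i).2))
      = simplexDet X + simplexDet (fun i => (f (X i).2, (X i).2)) := by
  have h := Matrix.det_updateCol_add (Matrix.of fun i => homog (X i)) 1 (fun i => (X i).1)
    (fun i => f (X i).2)
  have key (c : Fin (m + 2) → ℝ) : (Matrix.of fun i => homog (X i)).updateCol 1 c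
      = Matrix.of fun i => homog (c i, (X i).2) := by
    ext i j
    refine Fin.cases ?_ (fun j => ?_) j
    · simp [homog]
    · refine Fin.cases ?_ (fun j => ?_) j
      · simp [homog]
      · have : (j.succ.succ : Fin (m + 2)) ≠ 1 := by
          intro h; exact absurd (Fin.succ_injective _ h) (Fin.succ_ne_zero j)
        simp [homog, this]
  have hc : (fun i => (X i).1) + (fun i => f (X i).2) = fun i => (X i).1 + f (X i).2 := rfl
  simp only [key] at h
  exact h

/-- Averaging over the reflection in the height direction. -/
lemma two_abs_simplexDet_le (f : (Fin m → ℝ) → ℝ) (X : Fin (m + 2) → Pt m) :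
    2 * |simplexDet X| ≤
      |simplexDet (fun i => ((X i).1 + f (X i).2, (X i).2))| +
      |simplexDet (fun i => (-(X i).1 + f (X i).2, (X i).2))| := by
  have h1 := simplexDet_add_height f X
  have h2 := simplexDet_add_height f (fun i => (-(X i).1, (X i).2))
  have h3 := simplexDet_smul_height (-1) X
  simp only [neg_mul, one_mul] at h3 h2
  rw [h1, h2, h3]
  set A := simplexDet X
  set B := simplexDet (fun i => (f (X i).2, (X i).2))
  calc 2 * |A| = |(A + B) - (-A + B)| := by
        rw [show (A + B) - (-A + B) = 2 * A by ring, abs_mul, abs_two]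
    _ ≤ _ := abs_sub _ _

lemma abs_coneDet_smul (ε : Fin (m + 1) → ℝ) (hε : ∀ i, |ε i| = 1) (Y : Fin (m + 1) → Pt m) :
    |coneDet (fun i => ε i • Y i)| = |coneDet Y| := by
  have h := Matrix.det_mul_column ε
    (Matrix.of fun i => (Fin.cons (Y i).1 (Y i).2 : Fin (m + 1) → ℝ))
  have h2 : coneDet (fun i => ε i • Y i) = (∏ i, ε i) * coneDet Y := by
    unfold coneDet
    rw [← h]
    congr 1
    ext i j
    refine Fin.cases ?_ (fun j => ?_) j <;> simp
  rw [h2, abs_mul, Finset.abs_prod]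
  simp [hε]

lemma continuous_homog : Continuous (homog : Pt m → _) := by
  unfold homog
  refine continuous_pi fun j => ?_
  refine Fin.cases ?_ (fun j => ?_) j
  · simpa using continuous_const
  · refine Fin.cases ?_ (fun j => ?_) j
    · simpa using continuous_fst
    · simp only [Fin.cons_succ]; fun_prop

lemma continuous_simplexDet : Continuous (simplexDet : (Fin (m + 2) → Pt m) → ℝ) := by
  unfold simplexDet
  refine Continuous.matrix_det ?_
  refine continuous_pi fun i => ?_
  exact continuous_homog.comp (continuous_apply i)

lemma continuous_coneDet : Continuous (coneDet : (Fin (m + 1) → Pt m) → ℝ) := by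
  unfold coneDet
  refine Continuous.matrix_det (continuous_pi fun i => continuous_pi fun j => ?_)
  refine Fin.cases ?_ (fun j => ?_) j
  · simp only [Matrix.of_apply, Fin.cons_zero]; fun_prop
  · simp only [Matrix.of_apply, Fin.cons_succ]; fun_prop

lemma continuous_baseDet : Continuous (baseDet : (Fin (m + 1) → Fin m → ℝ) → ℝ) := by
  unfold baseDet
  refine Continuous.matrix_det (continuous_pi fun i => continuous_pi fun j => ?_)
  refine Fin.cases ?_ (fun j => ?_) j
  · simp only [Matrix.of_apply, Fin.cons_zero]; fun_prop
  · simp only [Matrix.of_apply, Fin.cons_succ]; fun_prop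

/-- The weight `(1 - p²)₊^{k/2}`. -/
noncomputable def capWeight (k : ℕ) (p : ℝ) : ℝ := √(1 - p ^ 2) ^ k

lemma capWeight_nonneg (k : ℕ) (p : ℝ) : 0 ≤ capWeight k p := by unfold capWeight; positivity

@[fun_prop]
lemma continuous_capWeight (k : ℕ) : Continuous (capWeight k) := by unfold capWeight; fun_prop

lemma capWeight_neg (k : ℕ) (p : ℝ) : capWeight k (-p) = capWeight k p := by simp [capWeight]

lemma capWeight_abs (k : ℕ) (p : ℝ) : capWeight k |p| = capWeight k p := by simp [capWeight]

lemma capWeight_eq_zero {k : ℕ} (hk : k ≠ 0) {p : ℝ} (hp : 1 ≤ |p|) : capWeight k p = 0 := by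
  have : 1 - p ^ 2 ≤ 0 := by
    rw [← sq_abs]; nlinarith
  simp [capWeight, Real.sqrt_eq_zero_of_nonpos this, hk]

lemma capWeight_even (n : ℕ) {p : ℝ} (hp : |p| ≤ 1) : capWeight (2 * n) p = (1 - p ^ 2) ^ n := by
  have : 0 ≤ 1 - p ^ 2 := by
    rw [← sq_abs]; nlinarith [abs_nonneg p]
  rw [capWeight, pow_mul, Real.sq_sqrt this]

/-- The integral of the weight over `[0, 1]`. -/
noncomputable def capIntegral (k : ℕ) : ℝ := ∫ p in (0 : ℝ)..1, capWeight k p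

lemma capIntegral_pos (k : ℕ) : 0 < capIntegral k := by
  refine intervalIntegral.intervalIntegral_pos_of_pos_on
    ((continuous_capWeight k).intervalIntegrable _ _) (fun x hx => ?_) one_pos
  have : 0 < 1 - x ^ 2 := by nlinarith [hx.1, hx.2]
  unfold capWeight; positivity

lemma lintegral_ofReal_even {f : ℝ → ℝ} (hf : Continuous f) (h0 : ∀ x, 0 ≤ f x)
    (he : ∀ x, f |x| = f x) (hs : ∀ x, 1 ≤ |x| → f x = 0) :
    ∫⁻ x, ENNReal.ofReal (f x) = ENNReal.ofReal (2 * ∫ x in (0 : ℝ)..1, f x) := by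
  have hc : HasCompactSupport f := by
    refine HasCompactSupport.of_support_subset_isCompact (isCompact_Icc (a := -1) (b := 1)) ?_
    intro x hx
    by_contra hn
    refine hx (hs x ?_)
    by_contra! h
    exact hn ⟨(abs_lt.1 h).1.le, (abs_lt.1 h).2.le⟩
  rw [← ofReal_integral_eq_lintegral_ofReal (hf.integrable_of_hasCompactSupport hc)
    (Filter.Eventually.of_forall h0)]
  congr 1
  calc ∫ x, f x = ∫ x, f |x| := by simp only [he]
    _ = 2 * ∫ x in Set.Ioi 0, f x := integral_comp_abs
    _ = _ := by
      rw [intervalIntegral.integral_of_le zero_le_one]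
      congr 1
      refine setIntegral_eq_of_subset_of_forall_sdiff_eq_zero (s := Set.Ioc 0 1)
        measurableSet_Ioi (fun x (hx : x ∈ Set.Ioc (0 : ℝ) 1) => hx.1) (fun x hx => ?_)
      refine hs x ?_
      have h1 : 0 < x := hx.1
      have h2 : ¬ x ≤ 1 := fun h => hx.2 ⟨h1, h⟩
      rw [abs_of_pos h1]; linarith

lemma lintegral_capWeight {k : ℕ} (hk : k ≠ 0) :
    ∫⁻ p, ENNReal.ofReal (capWeight k p) = ENNReal.ofReal (2 * capIntegral k) :=
  lintegral_ofReal_even (continuous_capWeight k) (capWeight_nonneg k) (capWeight_abs k)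
    fun _ => capWeight_eq_zero hk

lemma hasDerivAt_capWeight (k : ℕ) {x : ℝ} (hx : 0 < 1 - x ^ 2) :
    HasDerivAt (fun x => -capWeight (k + 2) x / (k + 2)) (x * capWeight k x) x := by
  have h1 : HasDerivAt (fun x : ℝ => 1 - x ^ 2) (-(2 * x)) x := by
    simpa using ((hasDerivAt_id x).pow 2).const_sub 1
  have h2 := ((h1.sqrt hx.ne').pow (k + 2)).neg.div_const ((k : ℝ) + 2)
  unfold capWeight
  have e : -(((k + 2 : ℕ) : ℝ) * √(1 - x ^ 2) ^ (k + 2 - 1) * (-(2 * x) / (2 * √(1 - x ^ 2))))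
      / ((k : ℝ) + 2) = x * √(1 - x ^ 2) ^ k := by
    have hs : √(1 - x ^ 2) ≠ 0 := (Real.sqrt_pos.2 hx).ne'
    have hk : (k : ℝ) + 2 ≠ 0 := by positivity
    rw [show k + 2 - 1 = k + 1 by omega, pow_succ]
    push_cast
    field_simp
  rw [← e]
  exact h2

lemma integral_mul_capWeight (k : ℕ) :
    ∫ p in (0 : ℝ)..1, p * capWeight k p = 1 / (k + 2) := by
  rw [intervalIntegral.integral_eq_sub_of_hasDerivAt_of_le
    (f := fun x => -capWeight (k + 2) x / (k + 2)) zero_le_one (by fun_prop)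
    (fun x hx => hasDerivAt_capWeight k (by nlinarith [hx.1, hx.2]))
    (Continuous.intervalIntegrable (by fun_prop) _ _)]
  simp [capWeight, neg_div]

lemma lintegral_abs_mul_capWeight {k : ℕ} (hk : k ≠ 0) :
    ∫⁻ p, ENNReal.ofReal (|p| * capWeight k p) = ENNReal.ofReal (2 / (k + 2)) := by
  rw [lintegral_ofReal_even (by fun_prop)
    (fun x => mul_nonneg (abs_nonneg _) (capWeight_nonneg _ _))
    (fun x => by rw [abs_abs, capWeight_abs]) (fun x hx => by rw [capWeight_eq_zero hk hx, mul_zero])]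
  rw [show ∫ x in (0 : ℝ)..1, |x| * capWeight k x = ∫ x in (0 : ℝ)..1, x * capWeight k x from
    intervalIntegral.integral_congr fun x hx => by
      rw [Set.uIcc_of_le zero_le_one] at hx
      simp only [abs_of_nonneg hx.1], integral_mul_capWeight]
  congr 1; ring

lemma capIntegral_even (n : ℕ) : capIntegral (2 * n) = ∫ x in (0 : ℝ)..1, (1 - x ^ 2) ^ n :=
  intervalIntegral.integral_congr fun x hx => by
    rw [Set.uIcc_of_le zero_le_one] at hx
    exact capWeight_even n (by rw [abs_of_nonneg hx.1]; exact hx.2)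

lemma capIntegral_even_succ (n : ℕ) :
    capIntegral (2 * (n + 1)) = (2 * n + 2) / (2 * n + 3) * capIntegral (2 * n) := by
  rw [capIntegral_even, capIntegral_even]
  have h : ∫ x in (0 : ℝ)..1, ((2 * n + 3) * (1 - x ^ 2) ^ (n + 1)
      - (2 * n + 2) * (1 - x ^ 2) ^ n) = 0 := by
    rw [intervalIntegral.integral_eq_sub_of_hasDerivAt
      (f := fun x : ℝ => x * (1 - x ^ 2) ^ (n + 1)) (fun x _ => ?_)
      (Continuous.intervalIntegrable (by fun_prop) _ _)]
    · simp
    · have h1 : HasDerivAt (fun x : ℝ => 1 - x ^ 2) (-(2 * x)) x := by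
        simpa using ((hasDerivAt_id x).pow 2).const_sub 1
      have h2 := (hasDerivAt_id x).mul (h1.pow (n + 1))
      refine h2.congr_deriv ?_
      simp only [id, Pi.pow_apply, Nat.add_sub_cancel]
      push_cast
      ring
  rw [intervalIntegral.integral_sub (Continuous.intervalIntegrable (by fun_prop) _ _)
    (Continuous.intervalIntegrable (by fun_prop) _ _), intervalIntegral.integral_const_mul,
    intervalIntegral.integral_const_mul] at h
  have : (2 * (n : ℝ) + 3) ≠ 0 := by positivity
  field_simp
  linarith

lemma capIntegral_zero : capIntegral (2 * 0) = 1 := by rw [capIntegral_even]; simp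

lemma capWeight_le_mul {γ : ℕ} (hγ : γ ≠ 0) (m : ℕ) {y : ℝ} (h0 : 0 ≤ y) (h1 : y ≤ 1) :
    capWeight m y ≤ capWeight (m * γ) (y / √γ) := by
  have hγ1 : (1 : ℝ) ≤ γ := by exact_mod_cast Nat.one_le_iff_ne_zero.2 hγ
  have e : (y / √γ) ^ 2 = y ^ 2 / γ := by rw [div_pow, Real.sq_sqrt (by positivity)]
  have hb : 1 - y ^ 2 ≤ (1 - (y / √γ) ^ 2) ^ γ := by
    have := one_add_mul_le_pow (a := -(y ^ 2 / γ)) (by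
      have : y ^ 2 / γ ≤ 1 := by
        rw [div_le_one (by positivity)]; nlinarith
      linarith) γ
    rw [e]
    calc 1 - y ^ 2 = 1 + (γ : ℝ) * -(y ^ 2 / γ) := by field_simp; ring
      _ ≤ _ := by simpa [sub_eq_add_neg] using this
  unfold capWeight
  rw [mul_comm m γ, pow_mul]
  refine pow_le_pow_left₀ (Real.sqrt_nonneg _) ?_ _
  calc √(1 - y ^ 2) ≤ √((1 - (y / √γ) ^ 2) ^ γ) := Real.sqrt_le_sqrt hb
    _ = _ := by
      have : 0 ≤ 1 - (y / √γ) ^ 2 := by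
        rw [e, sub_nonneg, div_le_one (by positivity)]; nlinarith
      rw [← Real.sqrt_sq (pow_nonneg (Real.sqrt_nonneg (1 - (y / √γ) ^ 2)) γ), ← pow_mul,
        mul_comm, pow_mul, Real.sq_sqrt this]

lemma capIntegral_div_sqrt_le {γ : ℕ} (hγ : γ ≠ 0) (m : ℕ) :
    capIntegral m / √γ ≤ capIntegral (m * γ) := by
  have hγ1 : (1 : ℝ) ≤ γ := by exact_mod_cast Nat.one_le_iff_ne_zero.2 hγ
  have hs : 1 ≤ √γ := Real.one_le_sqrt.2 hγ1
  have h1 : capIntegral m ≤ ∫ y in (0 : ℝ)..1, capWeight (m * γ) (y / √γ) :=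
    intervalIntegral.integral_mono_on zero_le_one
      (Continuous.intervalIntegrable (by fun_prop) _ _)
      (Continuous.intervalIntegrable (by fun_prop) _ _)
      (fun y hy => capWeight_le_mul hγ m hy.1 hy.2)
  rw [intervalIntegral.integral_comp_div _ (by positivity), smul_eq_mul, zero_div] at h1
  have h2 : ∫ y in (0 : ℝ)..(1 / √γ), capWeight (m * γ) y ≤ capIntegral (m * γ) := by
    refine intervalIntegral.integral_mono_interval le_rfl (by positivity)
      (by rw [div_le_one (by positivity)]; exact hs)
      (Filter.Eventually.of_forall fun x => capWeight_nonneg _ _)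
      (Continuous.intervalIntegrable (by fun_prop) _ _)
  rw [div_le_iff₀ (by positivity)]
  nlinarith

lemma capIntegral_three_le : capIntegral 3 ≤ 0.597 := by
  have h : ∀ x ∈ Set.Icc (0 : ℝ) 1, capWeight 3 x
      ≤ (5 / 9) * (1 - x ^ 2) ^ 2 + (9 / 20) * (1 - x ^ 2) ^ 1 := by
    intro x hx
    have h0 : 0 ≤ 1 - x ^ 2 := by nlinarith [hx.1, hx.2]
    have hs := Real.sq_sqrt h0
    have hn := Real.sqrt_nonneg (1 - x ^ 2)
    unfold capWeight
    set s := √(1 - x ^ 2)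
    rw [← hs]
    nlinarith [mul_nonneg (sq_nonneg s) (sq_nonneg (s - 9 / 10))]
  have h1 := intervalIntegral.integral_mono_on zero_le_one
      (Continuous.intervalIntegrable (μ := volume) (by fun_prop) (0 : ℝ) 1)
      (Continuous.intervalIntegrable (by fun_prop) _ _) h
  rw [intervalIntegral.integral_add (Continuous.intervalIntegrable (by fun_prop) _ _)
    (Continuous.intervalIntegrable (by fun_prop) _ _), intervalIntegral.integral_const_mul,
    intervalIntegral.integral_const_mul, ← capIntegral_even, ← capIntegral_even,
    capIntegral_even_succ 1, capIntegral_even_succ 0, capIntegral_zero] at h1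
  refine h1.trans ?_
  norm_num

/-- The one-dimensional inequality behind the comparison, for the bound
`max (|q| W) M` on the inner integral. -/
lemma two_mul_lt_integral_max {m : ℕ} (hm : 3 ≤ m) :
    4 / ((m * (m + 3) : ℕ) + 2 : ℝ) * capIntegral m <
      ∫ q in (0 : ℝ)..1, capWeight m q *
        max (q * (2 * capIntegral (m * (m + 3)))) (2 / ((m * (m + 3) : ℕ) + 2)) := by
  set W := 2 * capIntegral (m * (m + 3)) with hW
  set M : ℝ := 2 / ((m * (m + 3) : ℕ) + 2) with hM
  have h_integral : ∫ q in (0 : ℝ)..1, capWeight m q * (q * W) = W / (m + 2) := by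
    rw [show (fun q => capWeight m q * (q * W)) = fun q => W * (q * capWeight m q) by
      ext q; ring, intervalIntegral.integral_const_mul, integral_mul_capWeight]
    ring
  have hge : W / (m + 2) ≤ ∫ q in (0 : ℝ)..1, capWeight m q * max (q * W) M := by
    rw [← h_integral]
    refine intervalIntegral.integral_mono_on zero_le_one
      (Continuous.intervalIntegrable (by fun_prop) _ _)
      (Continuous.intervalIntegrable (by fun_prop) _ _) (fun q _ => ?_)
    exact mul_le_mul_of_nonneg_left (le_max_left _ _) (capWeight_nonneg _ _)
  rcases Nat.eq_or_lt_of_le hm with rfl | hm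
  · have h18 : W = 2 * capIntegral (2 * 9) := by rw [hW]
    have hM' : M = 1 / 10 := by rw [hM]; norm_num
    have hWv : W = 131072 / 230945 := by
      rw [h18, capIntegral_even_succ 8, capIntegral_even_succ 7, capIntegral_even_succ 6,
        capIntegral_even_succ 5, capIntegral_even_succ 4, capIntegral_even_succ 3,
        capIntegral_even_succ 2, capIntegral_even_succ 1, capIntegral_even_succ 0,
        capIntegral_zero]
      norm_num
    have hsplit : ∫ q in (0 : ℝ)..1, capWeight 3 q * max (q * W) M
        = (∫ q in (0 : ℝ)..1, capWeight 3 q * (q * W))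
          + ∫ q in (0 : ℝ)..1, capWeight 3 q * (max (q * W) M - q * W) := by
      rw [← intervalIntegral.integral_add (Continuous.intervalIntegrable (by fun_prop) _ _)
        (Continuous.intervalIntegrable (by fun_prop) _ _)]
      congr 1; ext q; ring
    have h1 : ∫ q in (0 : ℝ)..0.17, capWeight 3 q * (max (q * W) M - q * W) ≤
        ∫ q in (0 : ℝ)..1, capWeight 3 q * (max (q * W) M - q * W) := by
      refine intervalIntegral.integral_mono_interval le_rfl (by norm_num) (by norm_num)
        (Filter.Eventually.of_forall fun q => mul_nonneg (capWeight_nonneg _ _)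
          (sub_nonneg.2 (le_max_left _ _)))
        (Continuous.intervalIntegrable (by fun_prop) _ _)
    have h2 : ∫ q in (0 : ℝ)..0.17, (1 - 2 * q ^ 2) * (M - q * W) ≤
        ∫ q in (0 : ℝ)..0.17, capWeight 3 q * (max (q * W) M - q * W) := by
      refine intervalIntegral.integral_mono_on (by norm_num)
        (Continuous.intervalIntegrable (by fun_prop) _ _)
        (Continuous.intervalIntegrable (by fun_prop) _ _) (fun q hq => ?_)
      have hq0 := hq.1
      have hq1 := hq.2
      have hw : 0 ≤ 1 - q ^ 2 := by nlinarith
      have hs := Real.sq_sqrt hw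
      have hn := Real.sqrt_nonneg (1 - q ^ 2)
      have hn1 : √(1 - q ^ 2) ≤ 1 := Real.sqrt_le_one.2 (by nlinarith)
      have hb : 1 - 2 * q ^ 2 ≤ capWeight 3 q := by
        unfold capWeight
        set s := √(1 - q ^ 2)
        have : q ^ 2 = 1 - s ^ 2 := by linarith
        rw [this]
        nlinarith [mul_nonneg (mul_nonneg hn hn) (sub_nonneg.2 hn1),
          mul_nonneg hn (sub_nonneg.2 hn1), sq_nonneg (s - 1),
          mul_nonneg (sub_nonneg.2 hn1) (sub_nonneg.2 hn1),
          mul_nonneg hn (mul_nonneg (sub_nonneg.2 hn1) (sub_nonneg.2 hn1))]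
      refine mul_le_mul hb (sub_le_sub_right (le_max_right _ _) _) ?_ (capWeight_nonneg _ _)
      rw [hM', hWv]; norm_num at hq1 ⊢; linarith
    have h3 : ∫ q in (0 : ℝ)..0.17, (1 - 2 * q ^ 2) * (M - q * W)
        = M * (0.17 - 2 * 0.17 ^ 3 / 3) - W * (0.17 ^ 2 / 2 - 0.17 ^ 4 / 2) := by
      rw [intervalIntegral.integral_eq_sub_of_hasDerivAt
        (f := fun q : ℝ => M * (q - 2 * q ^ 3 / 3) - W * (q ^ 2 / 2 - q ^ 4 / 2))
        (fun q _ => ?_) (Continuous.intervalIntegrable (by fun_prop) _ _)]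
      · norm_num
      · have e3 := (hasDerivAt_id q).pow 3
        have e2 := (hasDerivAt_id q).pow 2
        have e4 := (hasDerivAt_id q).pow 4
        have := (((hasDerivAt_id q).sub ((e3.const_mul 2).div_const 3)).const_mul M).sub
          (((e2.div_const 2).sub (e4.div_const 2)).const_mul W)
        refine this.congr_deriv ?_
        simp only [id]
        norm_num
        ring
    have h4 := capIntegral_three_le
    have h5 : (4 / ((3 * (3 + 3) : ℕ) + 2 : ℝ)) = 1 / 5 := by norm_num
    rw [hsplit, h_integral, h5]
    rw [h3] at h2
    rw [hM', hWv] at h2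
    rw [hWv, hM']
    rw [hWv, hM'] at h1
    norm_num at h1 h2 h4 ⊢
    linarith
  · refine lt_of_lt_of_le ?_ hge
    have hp := capIntegral_pos m
    have hK : ((m * (m + 3) : ℕ) + 2 : ℝ) = (m + 1) * (m + 2) := by push_cast; ring
    have key : 2 * capIntegral m < (m + 1) * capIntegral (m * (m + 3)) := by
      rcases Nat.eq_or_lt_of_le hm with rfl | hm
      · rw [show 4 * (4 + 3) = 2 * 14 by norm_num]
        simp only [Nat.succ_eq_add_one]
        norm_num only
        rw [show (4 : ℕ) = 2 * 2 by norm_num, show (28 : ℕ) = 2 * 14 by norm_num]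
        simp only [capIntegral_even_succ 13, capIntegral_even_succ 12, capIntegral_even_succ 11,
          capIntegral_even_succ 10, capIntegral_even_succ 9, capIntegral_even_succ 8,
          capIntegral_even_succ 7, capIntegral_even_succ 6,
          capIntegral_even_succ 5, capIntegral_even_succ 4, capIntegral_even_succ 3,
          capIntegral_even_succ 2, capIntegral_even_succ 1, capIntegral_even_succ 0,
          capIntegral_zero]
        norm_num
      · have h := capIntegral_div_sqrt_le (γ := m + 3) (by omega) m
        have hs : 0 < √((m + 3 : ℕ) : ℝ) := by positivity
        rw [div_le_iff₀ hs] at h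
        have hm5 : (5 : ℝ) ≤ m := by exact_mod_cast hm
        have h2 : 2 * √((m + 3 : ℕ) : ℝ) < m + 1 := by
          have : √((m + 3 : ℕ) : ℝ) < (m + 1) / 2 := by
            rw [Real.sqrt_lt' (by positivity)]; push_cast; nlinarith
          linarith
        have := capIntegral_pos (m * (m + 3))
        nlinarith
    rw [hK, hW]
    have h1 : (0 : ℝ) < m + 1 := by positivity
    have h2 : (0 : ℝ) < m + 2 := by positivity
    rw [div_mul_eq_mul_div, div_lt_div_iff₀ (by positivity) (by positivity)]
    nlinarith [mul_pos h2 h2]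

lemma lintegral_capWeight_mul_le (k : ℕ) (q : ℝ) :
    ∫⁻ p, ENNReal.ofReal (capWeight k p) * ENNReal.ofReal (max |q| |p|) ≤
      ∫⁻ p, ENNReal.ofReal (capWeight k p) * ENNReal.ofReal |q - p| := by
  set A := ∫⁻ p, ENNReal.ofReal (capWeight k p) * ENNReal.ofReal |q - p| with hA
  have hneg : A = ∫⁻ p, ENNReal.ofReal (capWeight k p) * ENNReal.ofReal |q + p| := by
    rw [hA, ← lintegral_neg_eq_self]
    simp only [capWeight_neg, sub_neg_eq_add]
  have h2 : 2 * ∫⁻ p, ENNReal.ofReal (capWeight k p) * ENNReal.ofReal (max |q| |p|) ≤ 2 * A := by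
    calc _ = ∫⁻ p, 2 * (ENNReal.ofReal (capWeight k p) * ENNReal.ofReal (max |q| |p|)) := by
          rw [lintegral_const_mul' _ _ (by simp)]
      _ ≤ ∫⁻ p, (ENNReal.ofReal (capWeight k p) * ENNReal.ofReal |q - p|
          + ENNReal.ofReal (capWeight k p) * ENNReal.ofReal |q + p|) := by
          refine lintegral_mono fun p => ?_
          rw [← mul_add, ← ENNReal.ofReal_add (abs_nonneg _) (abs_nonneg _), mul_left_comm,
            show (2 : ENNReal) = ENNReal.ofReal 2 by simp, ← ENNReal.ofReal_mul zero_le_two]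
          gcongr
          have a1 : |(q - p) + (q + p)| ≤ _ := abs_add_le (q - p) (q + p)
          have a2 : |(q + p) - (q - p)| ≤ _ := abs_sub (q + p) (q - p)
          rw [show (q - p) + (q + p) = 2 * q by ring, abs_mul, abs_two] at a1
          rw [show (q + p) - (q - p) = 2 * p by ring, abs_mul, abs_two] at a2
          rcases max_cases |q| |p| with h | h <;> rw [h.1] <;> linarith
      _ = 2 * A := by
          rw [lintegral_add_left (by fun_prop), ← hneg, two_mul]
  exact (ENNReal.mul_le_mul_iff_right (by simp) (by simp)).1 h2

lemma lintegral_capWeight_comparison {m : ℕ} (hm : 3 ≤ m) :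
    2 * ((∫⁻ p, ENNReal.ofReal (capWeight (m * (m + 3)) p) * ENNReal.ofReal |p|)
      * ∫⁻ q, ENNReal.ofReal (capWeight m q)) <
    ∫⁻ q, ENNReal.ofReal (capWeight m q) *
      ∫⁻ p, ENNReal.ofReal (capWeight (m * (m + 3)) p) * ENNReal.ofReal |q - p| := by
  set K := m * (m + 3) with hK
  have hK0 : K ≠ 0 := by rw [hK]; positivity
  have hm0 : m ≠ 0 := by omega
  have hM : ∫⁻ p, ENNReal.ofReal (capWeight K p) * ENNReal.ofReal |p|
      = ENNReal.ofReal (2 / (K + 2)) := by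
    rw [← lintegral_abs_mul_capWeight hK0]
    congr 1; ext p
    rw [mul_comm, ENNReal.ofReal_mul (abs_nonneg _)]
  have hin (q : ℝ) : ENNReal.ofReal (max (|q| * (2 * capIntegral K)) (2 / (K + 2))) ≤
      ∫⁻ p, ENNReal.ofReal (capWeight K p) * ENNReal.ofReal |q - p| := by
    refine le_trans ?_ (lintegral_capWeight_mul_le K q)
    rw [ENNReal.ofReal_max]
    refine max_le ?_ ?_
    · rw [ENNReal.ofReal_mul (abs_nonneg _), ← lintegral_capWeight hK0, mul_comm,
        ← lintegral_mul_const' _ _ (by simp)]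
      gcongr
      exact le_max_left _ _
    · rw [← hM]
      gcongr
      exact le_max_right _ _
  refine lt_of_lt_of_le ?_ (lintegral_mono fun q => mul_le_mul_right (hin q) _)
  rw [hM]
  simp_rw [← ENNReal.ofReal_mul (capWeight_nonneg _ _)]
  rw [ lintegral_capWeight hm0, lintegral_ofReal_even (by fun_prop)
    (fun x => mul_nonneg (capWeight_nonneg _ _) (le_max_of_le_right (by positivity)))
    (fun x => by rw [abs_abs, capWeight_abs])
    (fun x hx => by rw [capWeight_eq_zero hm0 hx, zero_mul]),
    ← ENNReal.ofReal_mul (by positivity), show (2 : ENNReal) = ENNReal.ofReal 2 by simp,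
    ← ENNReal.ofReal_mul zero_le_two]
  have h := two_mul_lt_integral_max hm
  have h' : ∫ x in (0 : ℝ)..1, capWeight m x * max (|x| * (2 * capIntegral K)) (2 / (K + 2))
      = ∫ x in (0 : ℝ)..1, capWeight m x * max (x * (2 * capIntegral K)) (2 / (K + 2)) :=
    intervalIntegral.integral_congr fun x hx => by
      rw [Set.uIcc_of_le zero_le_one] at hx
      simp only [abs_of_nonneg hx.1]
  rw [h']
  rw [ENNReal.ofReal_lt_ofReal_iff_of_nonneg]
  · have e : 2 * (2 / ((K : ℝ) + 2) * (2 * capIntegral m))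
      = 2 * (4 / (K + 2) * capIntegral m) := by ring
    rw [e]
    linarith
  · have := (capIntegral_pos m).le
    positivity

/-- The signed volume, up to a factorial, of the simplex with the given vertices. -/
def affDet {k : ℕ} (v : Fin (k + 1) → Fin k → ℝ) : ℝ :=
  (Matrix.of fun i => (Fin.cons 1 (v i) : Fin (k + 1) → ℝ)).det

lemma affDet_eq {k : ℕ} (v : Fin (k + 1) → Fin k → ℝ) :
    affDet v = (Matrix.of fun i j : Fin k => v i.succ j - v 0 j).det := by
  have h : affDet v = (Matrix.of (Fin.cons (Fin.cons 1 (v 0)) fun i => Fin.cons 0 (v i.succ - v 0) :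
      Fin (k + 1) → Fin (k + 1) → ℝ)).det := by
    refine Matrix.det_eq_of_forall_row_eq_smul_add_const (fun i => if i = 0 then 0 else 1) 0
      (by simp) ?_
    intro i j
    refine Fin.cases ?_ (fun i => ?_) i <;> refine Fin.cases ?_ (fun j => ?_) j <;> simp
  rw [h, Matrix.det_succ_column_zero, Fin.sum_univ_succ, Finset.sum_eq_zero]
  · simp
    rfl
  · intro i _
    simp

lemma ae_affDet_ne_zero (k : ℕ) :
    ∀ᵐ v : Fin (k + 1) → Fin k → ℝ, affDet v ≠ 0 := by
  let w : Fin (k + 1) → Fin k → ℝ := Fin.cons 0 fun i => Pi.single i 1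
  let L : ℝ →ₗ[ℝ] (Fin (k + 1) → Fin k → ℝ) := LinearMap.toSpanSingleton ℝ _ w
  have hcont : Continuous (affDet : (Fin (k + 1) → Fin k → ℝ) → ℝ) := by
    unfold affDet
    refine Continuous.matrix_det (continuous_pi fun i => continuous_pi fun j => ?_)
    refine Fin.cases ?_ (fun j => ?_) j
    · simp only [Matrix.of_apply, Fin.cons_zero]; fun_prop
    · simp only [Matrix.of_apply, Fin.cons_succ]; fun_prop
  refine ae_mem_of_ae_add_linearMap_mem L volume volume
    (s := {v : Fin (k + 1) → Fin k → ℝ | affDet v ≠ 0})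
    (hcont.measurable (measurableSet_singleton 0).compl) fun v => ?_
  let C : Matrix (Fin k) (Fin k) ℝ := Matrix.of fun i j => v i.succ j - v 0 j
  let P : Polynomial ℝ := Matrix.det
    ((Polynomial.X : Polynomial ℝ) • (1 : Matrix (Fin k) (Fin k) (Polynomial ℝ))
      + C.map Polynomial.C)
  have hP : P ≠ 0 := by
    intro h
    have := Polynomial.leadingCoeff_det_X_one_add_C C
    rw [show Matrix.det _ = (0 : Polynomial ℝ) from h] at this
    simp at this
  have hfin : {x : ℝ | P.IsRoot x}.Finite := Polynomial.finite_setOfPred_isRoot hP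
  refine measure_mono_null (fun x hx => ?_) (hfin.measure_zero volume)
  have hx' : affDet (v + L x) = 0 := by simpa using hx
  rw [affDet_eq] at hx'
  rw [Set.mem_ofPred_eq, Polynomial.IsRoot, ← Polynomial.coe_evalRingHom, RingHom.map_det, ← hx']
  congr 1
  ext i j
  by_cases hij : i = j
  · subst hij
    simp [L, w, C]
    ring
  · simp [L, w, C, Matrix.one_apply_ne hij, Pi.single_eq_of_ne (Ne.symm hij)]

/-- The points of the graph of the affine function with coefficients `p` over the points `z`. -/
def graphPts (p : Pt m) (z : Fin (m + 1) → Fin m → ℝ) : Fin (m + 1) → Pt m :=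
  fun i => (p.1 + p.2 ⬝ᵥ z i, z i)

lemma lintegral_height (z : Fin (m + 1) → Fin m → ℝ) (hz : baseDet z ≠ 0)
    (G : (Fin (m + 1) → ℝ) → ENNReal) (hG : Measurable G) :
    ∫⁻ t, G t = ∫⁻ p : Pt m, ENNReal.ofReal |baseDet z| * G (fun i => p.1 + p.2 ⬝ᵥ z i) := by
  let Z : Matrix (Fin (m + 1)) (Fin (m + 1)) ℝ :=
    Matrix.of fun i => (Fin.cons 1 (z i) : Fin (m + 1) → ℝ)
  have hZ : Z.det = baseDet z := rfl
  have h := Real.map_matrix_volume_pi_eq_smul_volume_pi (M := Z) (by rwa [hZ])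
  have hc : ENNReal.ofReal |baseDet z| * ENNReal.ofReal |(Z.det)⁻¹| = 1 := by
    rw [← ENNReal.ofReal_mul (abs_nonneg _), hZ, abs_inv, mul_inv_cancel₀ (abs_ne_zero.2 hz),
      ENNReal.ofReal_one]
  have hv : (volume : Measure (Fin (m + 1) → ℝ)) =
      ENNReal.ofReal |baseDet z| • Measure.map (Matrix.toLin' Z) volume := by
    rw [h, smul_smul, hc, one_smul]
  have hZm : Measurable (Matrix.toLin' Z) :=
    (LinearMap.continuous_of_finiteDimensional _).measurable
  rw [hv, lintegral_smul_measure, lintegral_map hG hZm]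
  have e := (volume_preserving_piFinSuccAbove (fun _ : Fin (m + 1) => ℝ) 0).symm
  rw [← e.lintegral_comp_emb (MeasurableEquiv.measurableEmbedding _), smul_eq_mul,
    ← lintegral_const_mul' _ _ ENNReal.ofReal_ne_top]
  refine lintegral_congr fun p => ?_
  congr 2
  ext i
  simp [Z, Matrix.mulVec, dotProduct, Fin.sum_univ_succ, MeasurableEquiv.piFinSuccAbove, mul_comm]

@[fun_prop]
lemma measurable_graphPts :
    Measurable fun x : Pt m × (Fin (m + 1) → Fin m → ℝ) => graphPts x.1 x.2 := by
  unfold graphPts dotProduct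
  fun_prop

lemma lintegral_graphPts (G : (Fin (m + 1) → Pt m) → ENNReal) (hG : Measurable G) :
    ∫⁻ Y, G Y = ∫⁻ p : Pt m, ∫⁻ z : Fin (m + 1) → Fin m → ℝ,
      ENNReal.ofReal |baseDet z| * G (graphPts p z) := by
  have e := (volume_measurePreserving_arrowProdEquivProdArrow ℝ (Fin m → ℝ) (Fin (m + 1))).symm
  have hm := (MeasurableEquiv.arrowProdEquivProdArrow ℝ (Fin m → ℝ) (Fin (m + 1))).symm.measurable
  have hb : Measurable (baseDet : (Fin (m + 1) → Fin m → ℝ) → ℝ) := continuous_baseDet.measurable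
  rw [← e.lintegral_comp_emb (MeasurableEquiv.measurableEmbedding _)]
  rw [Measure.volume_eq_prod, lintegral_prod_symm
    (fun x => G ((MeasurableEquiv.arrowProdEquivProdArrow ℝ (Fin m → ℝ) (Fin (m + 1))).symm x))
    (hG.comp hm).aemeasurable]
  symm
  rw [lintegral_lintegral_swap]
  · symm
    refine lintegral_congr_ae ?_
    filter_upwards [ae_affDet_ne_zero m] with z hz
    exact lintegral_height z hz
      (fun t => G ((MeasurableEquiv.arrowProdEquivProdArrow ℝ (Fin m → ℝ) (Fin (m + 1))).symm (t, z)))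
      (hG.comp (hm.comp (by fun_prop)))
  · refine Measurable.aemeasurable ?_
    exact (ENNReal.measurable_ofReal.comp ((continuous_abs.measurable.comp hb).comp
      measurable_snd)).mul (hG.comp measurable_graphPts)

lemma exists_volume_convexHull (d : ℕ) : ∃ c : ENNReal, c ≠ 0 ∧ c ≠ ⊤ ∧
    ∀ X : Fin (d + 1) → EuclideanSpace ℝ (Fin d),
      volume (convexHull ℝ (Set.range X)) = c * ENNReal.ofReal |affDet fun i => (X i).ofLp| := by
  let b := (EuclideanSpace.basisFun (Fin d) ℝ).toBasis
  let p : Fin (d + 1) → EuclideanSpace ℝ (Fin d) := Fin.cons 0 b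
  refine ⟨volume (convexHull ℝ (Set.range p)), ?_, ?_, fun X => ?_⟩
  · have hi : (interior (convexHull ℝ (Set.range p))).Nonempty := by
      rw [interior_convexHull_nonempty_iff_affineSpan_eq_top, Fin.range_cons,
        ← SetLike.coe_set_eq, affineSpan_insert_zero, b.span_eq]
      rfl
    exact (isOpen_interior.measure_pos _ hi |>.trans_le (measure_mono interior_subset)).ne'
  · exact ((Set.finite_range p).isCompact_convexHull (𝕜 := ℝ)).measure_lt_top.ne
  · let M : Matrix (Fin d) (Fin d) ℝ := Matrix.of fun i j => (X i.succ).ofLp j - (X 0).ofLp j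
    let L := Matrix.toLin b b M.transpose
    have hL (i : Fin d) : L (b i) = X i.succ - X 0 := by
      rw [Matrix.toLin_self]
      ext j
      simp [b, M, Pi.single_apply]
    let f : EuclideanSpace ℝ (Fin d) →ᵃ[ℝ] EuclideanSpace ℝ (Fin d) :=
      L.toAffineMap + AffineMap.const ℝ _ (X 0)
    have hf : f ∘ p = X := by
      ext i : 1
      refine Fin.cases ?_ (fun i => ?_) i
      · simp [f, p]
      · simp [f, p, hL]
    have hr : Set.range X = f '' Set.range p := by rw [← Set.range_comp, hf]
    rw [hr, ← AffineMap.image_convexHull]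
    have hi : f '' convexHull ℝ (Set.range p) = X 0 +ᵥ (L '' convexHull ℝ (Set.range p)) := by
      rw [← Set.image_vadd, Set.image_image]
      refine Set.image_congr fun x _ => ?_
      simp [f, add_comm]
    rw [hi, measure_vadd, Measure.addHaar_image_linearMap, mul_comm, LinearMap.det_toLin,
      Matrix.det_transpose, affDet_eq]

/-- The power `A ^ n` as a set of configurations. -/
abbrev powSet {E : Type*} (n : ℕ) (A : Set E) : Set (Fin n → E) := Set.univ.pi fun _ => A

/-- The total volume, up to a factorial, of simplices with all vertices in `A`. -/
noncomputable def simplexIntegral (A : Set (Pt m)) : ENNReal :=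
  ∫⁻ X in powSet (m + 2) A, ENNReal.ofReal |simplexDet X|

/-- The total volume, up to a factorial, of simplices with one vertex `y` and the others in `A`. -/
noncomputable def coneIntegral (A : Set (Pt m)) (y : Pt m) : ENNReal :=
  ∫⁻ Y in powSet (m + 1) A,
    ENNReal.ofReal |simplexDet (Fin.cons y Y : Fin (m + 2) → Pt m)|

lemma lintegral_powSet_succ {E : Type*} [MeasureSpace E] [SigmaFinite (volume : Measure E)]
    {n : ℕ} (i : Fin (n + 1)) (A : Set E) (B : Set E) {F : (Fin (n + 1) → E) → ENNReal}
    (hF : Measurable F) :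
    ∫⁻ X in Set.univ.pi (i.insertNth A fun _ => B : Fin (n + 1) → Set E), F X
      = ∫⁻ y in A, ∫⁻ Y in powSet n B, F (i.insertNth y Y) := by
  have e := (measurePreserving_piFinSuccAbove (α := fun _ : Fin (n + 1) => E)
    (fun j => (volume : Measure E).restrict ((i.insertNth A fun _ => B : Fin (n + 1) → Set E) j))
    i).symm
  rw [volume_pi, Measure.restrict_pi_pi, ← e.lintegral_comp_emb
    (MeasurableEquiv.measurableEmbedding _)]
  simp only [Fin.insertNth_apply_same, Fin.insertNth_apply_succAbove]
  rw [lintegral_prod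
    (fun x => F ((MeasurableEquiv.piFinSuccAbove (fun _ => E) i).symm x))
    (hF.comp (MeasurableEquiv.measurable _)).aemeasurable]
  simp only [volume_pi, Measure.restrict_pi_pi]
  rfl

lemma continuous_cons {E : Type*} [TopologicalSpace E] {n : ℕ} :
    Continuous fun x : E × (Fin n → E) => (Fin.cons x.1 x.2 : Fin (n + 1) → E) := by
  refine continuous_pi fun j => ?_
  refine Fin.cases ?_ (fun j => ?_) j
  · simpa using continuous_fst
  · simp only [Fin.cons_succ]; fun_prop

lemma continuous_abs_simplexDet_cons :
    Continuous fun x : Pt m × (Fin (m + 1) → Pt m) =>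
      |simplexDet (Fin.cons x.1 x.2 : Fin (m + 2) → Pt m)| :=
  (continuous_simplexDet.comp continuous_cons).abs

lemma insertNth_const {E : Type*} {n : ℕ} (i : Fin (n + 1)) (x : E) :
    (i.insertNth x fun _ => x : Fin (n + 1) → E) = fun _ => x := by
  ext j
  refine i.succAboveCases ?_ (fun j => ?_) j <;> simp

lemma lintegral_insertNth (i : Fin (m + 2)) (C A : Set (Pt m)) :
    ∫⁻ X in Set.univ.pi (i.insertNth C fun _ => A : Fin (m + 2) → Set (Pt m)),
      ENNReal.ofReal |simplexDet X| = ∫⁻ y in C, coneIntegral A y := by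
  rw [lintegral_powSet_succ i C A (F := fun X => ENNReal.ofReal |simplexDet X|)
    continuous_simplexDet.abs.measurable.ennreal_ofReal]
  simp only [abs_simplexDet_insertNth]
  rfl

lemma simplexIntegral_eq (A : Set (Pt m)) :
    simplexIntegral A = ∫⁻ y in A, coneIntegral A y := by
  rw [← lintegral_insertNth 0, insertNth_const]
  rfl

/-- The density of configurations on a common hyperplane, in terms of the coefficients of the
hyperplane. -/
noncomputable def graphDensity (A : Set (Pt m)) (p : Pt m) : ENNReal :=
  ∫⁻ z in powSet (m + 1) ((fun w : Fin m → ℝ => ((p.1 + p.2 ⬝ᵥ w, w) : Pt m)) ⁻¹' A), ENNReal.ofReal (baseDet z ^ 2)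

lemma powSet_measurableSet {E : Type*} [MeasurableSpace E] {n : ℕ} {A : Set E}
    (hA : MeasurableSet A) : MeasurableSet (powSet n A) :=
  MeasurableSet.univ_pi fun _ => hA

lemma measurable_graph (p : Pt m) : Measurable fun w : Fin m → ℝ => (p.1 + p.2 ⬝ᵥ w, w) := by
  unfold dotProduct; fun_prop

lemma graphDensity_eq {A : Set (Pt m)} (hA : MeasurableSet A) (p : Pt m) :
    graphDensity A p = ∫⁻ z : Fin (m + 1) → Fin m → ℝ, ENNReal.ofReal (baseDet z ^ 2) *
      (powSet (m + 1) A).indicator 1 (graphPts p z) := by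
  rw [graphDensity, ← lintegral_indicator (powSet_measurableSet (measurable_graph p hA))]
  refine lintegral_congr fun z => ?_
  have : z ∈ powSet (m + 1) ((fun w : Fin m → ℝ => ((p.1 + p.2 ⬝ᵥ w, w) : Pt m)) ⁻¹' A) ↔
      graphPts p z ∈ powSet (m + 1) A := by
    simp [graphPts, Set.mem_pi]
  by_cases h : graphPts p z ∈ powSet (m + 1) A
  · rw [Set.indicator_of_mem (this.2 h), Set.indicator_of_mem h]; simp
  · rw [Set.indicator_of_notMem (fun h' => h (this.1 h')), Set.indicator_of_notMem h]; simp

lemma measurable_graphDensity {A : Set (Pt m)} (hA : MeasurableSet A) :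
    Measurable (graphDensity A) := by
  have : graphDensity A = fun p => ∫⁻ z : Fin (m + 1) → Fin m → ℝ,
      ENNReal.ofReal (baseDet z ^ 2) * (powSet (m + 1) A).indicator 1 (graphPts p z) :=
    funext (graphDensity_eq hA)
  rw [this]
  refine Measurable.lintegral_prod_right' (f := fun x : Pt m × (Fin (m + 1) → Fin m → ℝ) =>
    ENNReal.ofReal (baseDet x.2 ^ 2) * (powSet (m + 1) A).indicator 1 (graphPts x.1 x.2)) ?_
  refine Measurable.mul ?_ ?_
  · exact ((continuous_baseDet.measurable.comp measurable_snd).pow_const 2).ennreal_ofReal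
  · exact (measurable_one.indicator (powSet_measurableSet hA)).comp measurable_graphPts

lemma coneIntegral_eq {A : Set (Pt m)} (hA : MeasurableSet A) (y : Pt m) :
    coneIntegral A y =
      ∫⁻ p : Pt m, ENNReal.ofReal |y.1 - (p.1 + p.2 ⬝ᵥ y.2)| * graphDensity A p := by
  have hm : Measurable fun Y : Fin (m + 1) → Pt m =>
      ENNReal.ofReal |simplexDet (Fin.cons y Y : Fin (m + 2) → Pt m)| :=
    (continuous_abs_simplexDet_cons.comp (by fun_prop : Continuous fun Y => (y, Y))).measurable.ennreal_ofReal
  rw [coneIntegral, ← lintegral_indicator (powSet_measurableSet hA),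
    lintegral_graphPts _ (hm.indicator (powSet_measurableSet hA))]
  refine lintegral_congr fun p => ?_
  rw [graphDensity_eq hA, ← lintegral_const_mul' _ _ ENNReal.ofReal_ne_top]
  refine lintegral_congr fun z => ?_
  have hs := abs_simplexDet_cons_graph y p.1 p.2 z
  by_cases h : graphPts p z ∈ powSet (m + 1) A
  · rw [Set.indicator_of_mem h, Set.indicator_of_mem h, Pi.one_apply, mul_one]
    unfold graphPts
    rw [hs, ← ENNReal.ofReal_mul (abs_nonneg _), ← ENNReal.ofReal_mul (abs_nonneg _)]
    congr 1
    rw [← sq_abs]; ring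
  · rw [Set.indicator_of_notMem h, Set.indicator_of_notMem h]; simp

lemma simplexIntegral_ne_top {A : Set (Pt m)} (hA : IsCompact A) : simplexIntegral A ≠ ⊤ := by
  have hc : IsCompact (powSet (m + 2) A) := isCompact_univ_pi fun _ => hA
  have := (continuous_simplexDet (m := m)).abs.continuousOn.integrableOn_compact (μ := volume) hc
  have h2 := this.2
  unfold HasFiniteIntegral at h2
  refine ne_of_lt (lt_of_le_of_lt (le_of_eq ?_) h2)
  refine lintegral_congr fun X => ?_
  rw [Real.enorm_eq_ofReal_abs, abs_abs]

/-- Points of `ℝ × ℝᵐ` as vectors. -/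
def vecEquiv (m : ℕ) : (Fin (m + 1) → ℝ) ≃ᵐ Pt m :=
  MeasurableEquiv.piFinSuccAbove (fun _ => ℝ) 0

lemma vecEquiv_symm (x : Pt m) : (vecEquiv m).symm x = Fin.cons x.1 x.2 := by
  simp [vecEquiv, MeasurableEquiv.piFinSuccAbove]
  rfl

lemma measurePreserving_vecEquiv (m : ℕ) : MeasurePreserving (vecEquiv m) :=
  volume_preserving_piFinSuccAbove (fun _ => ℝ) 0

lemma ae_simplexDet_ne_zero : ∀ᵐ X : Fin (m + 2) → Pt m, simplexDet X ≠ 0 := by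
  have h := volume_preserving_pi (ι := Fin (m + 2)) fun _ => (measurePreserving_vecEquiv m).symm
  have h2 := h.quasiMeasurePreserving.tendsto_ae.eventually (ae_affDet_ne_zero (m + 1))
  filter_upwards [h2] with X hX
  simp only [affDet, vecEquiv_symm] at hX
  exact hX

lemma simplexIntegral_ne_zero {A : Set (Pt m)} (hA : volume A ≠ 0) : simplexIntegral A ≠ 0 := by
  intro h
  rw [simplexIntegral, lintegral_eq_zero_iff
    continuous_simplexDet.abs.measurable.ennreal_ofReal] at h
  have h2 : ∀ᵐ X ∂(volume.restrict (powSet (m + 2) A)), False := by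
    filter_upwards [h, ae_restrict_of_ae ae_simplexDet_ne_zero] with X h1 h2
    simp only [Pi.zero_apply, ENNReal.ofReal_eq_zero] at h1
    exact h2 (abs_nonpos_iff.1 h1)
  rw [Filter.eventually_false_iff_eq_bot, ae_eq_bot, Measure.restrict_eq_zero, volume_pi_pi,
    Finset.prod_const] at h2
  exact hA (pow_eq_zero_iff (by simp) |>.1 h2)

lemma coneIntegral_zero (A : Set (Pt m)) :
    coneIntegral A 0 = ∫⁻ Y in powSet (m + 1) A, ENNReal.ofReal |coneDet Y| := by
  simp only [coneIntegral, simplexDet_cons_zero]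

lemma lintegral_comp_add_smul {E : Type*} [NormedAddCommGroup E] [NormedSpace ℝ E]
    [MeasureSpace E] [BorelSpace E] [FiniteDimensional ℝ E]
    [(volume : Measure E).IsAddHaarMeasure] (f : E → ENNReal) {c : ℝ} (hc : 0 < c) (x : E) :
    ∫⁻ y, f y = ENNReal.ofReal (c ^ Module.finrank ℝ E) * ∫⁻ y, f (x + c • y) := by
  rw [← lintegral_add_left_eq_self f x]
  have h := Measure.map_addHaar_smul (volume : Measure E) hc.ne'
  have he : MeasurableEmbedding fun y : E => c • y :=
    (Homeomorph.smulOfNeZero c hc.ne').measurableEmbedding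
  have := he.lintegral_map (μ := volume) fun y => f (x + y)
  rw [← this, h, lintegral_smul_measure, smul_eq_mul, ← mul_assoc, ← ENNReal.ofReal_mul (by positivity),
    abs_of_pos (by positivity), mul_inv_cancel₀ (by positivity), ENNReal.ofReal_one, one_mul]

/-- The Euclidean unit ball. -/
def unitBall (m : ℕ) : Set (Pt m) := {x | x.1 ^ 2 + x.2 ⬝ᵥ x.2 ≤ 1}

lemma isClosed_unitBall : IsClosed (unitBall m) := by
  unfold unitBall dotProduct
  exact isClosed_le (by fun_prop) continuous_const

lemma dotProduct_self_nonneg_real (z : Fin m → ℝ) : 0 ≤ z ⬝ᵥ z :=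
  Finset.sum_nonneg fun i _ => mul_self_nonneg (z i)

lemma sq_le_dotProduct_self (z : Fin m → ℝ) (i : Fin m) : z i ^ 2 ≤ z ⬝ᵥ z := by
  rw [sq]
  exact Finset.single_le_sum (f := fun i => z i * z i) (fun i _ => mul_self_nonneg (z i))
    (Finset.mem_univ i)

lemma unitBall_subset : unitBall m ⊆ Metric.closedBall 0 1 := by
  intro x hx
  have hx' : x.1 ^ 2 + x.2 ⬝ᵥ x.2 ≤ 1 := hx
  have h1 := dotProduct_self_nonneg_real x.2
  rw [mem_closedBall_zero_iff, Prod.norm_def, max_le_iff, pi_norm_le_iff_of_nonneg zero_le_one]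
  refine ⟨?_, fun i => ?_⟩
  · rw [Real.norm_eq_abs, abs_le_one_iff_mul_self_le_one]; nlinarith
  · rw [Real.norm_eq_abs, abs_le_one_iff_mul_self_le_one]
    nlinarith [sq_le_dotProduct_self x.2 i, sq_nonneg x.1]

lemma isCompact_unitBall : IsCompact (unitBall m) :=
  (isCompact_closedBall 0 1).of_isClosed_subset isClosed_unitBall unitBall_subset

lemma measurableSet_unitBall : MeasurableSet (unitBall m) := isClosed_unitBall.measurableSet

lemma volume_unitBall_ne_zero : volume (unitBall m) ≠ 0 := by
  have ho : IsOpen {x : Pt m | x.1 ^ 2 + x.2 ⬝ᵥ x.2 < 1} := by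
    unfold dotProduct
    exact isOpen_lt (by fun_prop) continuous_const
  have : 0 < volume {x : Pt m | x.1 ^ 2 + x.2 ⬝ᵥ x.2 < 1} := ho.measure_pos _ ⟨0, by simp⟩
  exact (this.trans_le (measure_mono fun x hx => le_of_lt (by simpa using hx))).ne'

/-- The section of the unit ball by a hyperplane, projected along the first coordinate. -/
def ballSection (p : Pt m) : Set (Fin m → ℝ) := {z | (p.1 + p.2 ⬝ᵥ z, z) ∈ unitBall m}

/-- The length of the normal vector of a hyperplane given as a graph. -/
noncomputable def graphSlope (b : Fin m → ℝ) : ℝ := √(1 + b ⬝ᵥ b)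

lemma graphSlope_pos (b : Fin m → ℝ) : 0 < graphSlope b :=
  Real.sqrt_pos.2 (by linarith [dotProduct_self_nonneg_real b])

lemma graphSlope_sq (b : Fin m → ℝ) : graphSlope b ^ 2 = 1 + b ⬝ᵥ b :=
  Real.sq_sqrt (by linarith [dotProduct_self_nonneg_real b])

/-- The centre of a hyperplane section. -/
noncomputable def sectionCenter (p : Pt m) : Fin m → ℝ := (-(p.1 / graphSlope p.2 ^ 2)) • p.2

lemma mem_ballSection_add (p : Pt m) (u : Fin m → ℝ) :
    sectionCenter p + u ∈ ballSection p ↔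
      (p.1 / graphSlope p.2) ^ 2 + ((p.2 ⬝ᵥ u) ^ 2 + u ⬝ᵥ u) ≤ 1 := by
  have hs := graphSlope_pos p.2
  have h2 := graphSlope_sq p.2
  simp only [ballSection, unitBall, Set.mem_ofPred_eq, sectionCenter, dotProduct_add,
    add_dotProduct, dotProduct_smul, smul_dotProduct, smul_eq_mul, dotProduct_comm u p.2]
  have hb : p.2 ⬝ᵥ p.2 = graphSlope p.2 ^ 2 - 1 := by linarith
  rw [hb]
  have key : (p.1 + (-(p.1 / graphSlope p.2 ^ 2) * (graphSlope p.2 ^ 2 - 1) + p.2 ⬝ᵥ u)) ^ 2 +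
      (-(p.1 / graphSlope p.2 ^ 2) * (-(p.1 / graphSlope p.2 ^ 2) * (graphSlope p.2 ^ 2 - 1))
        + -(p.1 / graphSlope p.2 ^ 2) * (p.2 ⬝ᵥ u) +
        (-(p.1 / graphSlope p.2 ^ 2) * (p.2 ⬝ᵥ u) + u ⬝ᵥ u))
      = (p.1 / graphSlope p.2) ^ 2 + ((p.2 ⬝ᵥ u) ^ 2 + u ⬝ᵥ u) := by
    field_simp
    ring
  rw [← key]
  ring_nf

lemma mem_ballSection_zero (b w : Fin m → ℝ) :
    w ∈ ballSection ((0 : ℝ), b) ↔ (b ⬝ᵥ w) ^ 2 + w ⬝ᵥ w ≤ 1 := by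
  simp [ballSection, unitBall]

lemma mem_ballSection_smul (p : Pt m) (hp : |p.1 / graphSlope p.2| < 1) (w : Fin m → ℝ) :
    sectionCenter p + √(1 - (p.1 / graphSlope p.2) ^ 2) • w ∈ ballSection p ↔
      w ∈ ballSection ((0 : ℝ), p.2) := by
  rw [mem_ballSection_add, mem_ballSection_zero]
  have h1 : 0 < 1 - (p.1 / graphSlope p.2) ^ 2 := by
    rw [sub_pos, ← sq_abs]; nlinarith [abs_nonneg (p.1 / graphSlope p.2)]
  have h2 := Real.sq_sqrt h1.le
  simp only [dotProduct_smul, smul_dotProduct, smul_eq_mul]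
  set c := √(1 - (p.1 / graphSlope p.2) ^ 2)
  have : (p.1 / graphSlope p.2) ^ 2 = 1 - c ^ 2 := by linarith
  rw [this] at h1 ⊢
  constructor
  · intro h; nlinarith
  · intro h; nlinarith

lemma ballSection_subset (p : Pt m) (hp : 1 ≤ |p.1 / graphSlope p.2|) :
    ballSection p ⊆ {sectionCenter p} := by
  intro z hz
  have h := (mem_ballSection_add p (z - sectionCenter p)).1 (by simpa using hz)
  have h1 : 1 ≤ (p.1 / graphSlope p.2) ^ 2 := by rw [← sq_abs]; nlinarith
  have h2 : (z - sectionCenter p) ⬝ᵥ (z - sectionCenter p) = 0 :=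
    le_antisymm (by nlinarith [sq_nonneg (p.2 ⬝ᵥ (z - sectionCenter p))])
      (dotProduct_self_nonneg_real _)
  exact sub_eq_zero.1 (dotProduct_self_eq_zero.1 h2)

lemma measurableSet_ballSection (p : Pt m) : MeasurableSet (ballSection p) :=
  measurable_graph p measurableSet_unitBall

lemma volume_ballSection (hm : m ≠ 0) (p : Pt m) :
    volume (ballSection p) = ENNReal.ofReal (capWeight m (p.1 / graphSlope p.2)) *
      volume (ballSection ((0 : ℝ), p.2)) := by
  rcases lt_or_ge |p.1 / graphSlope p.2| 1 with hp | hp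
  · have h1 : 0 < 1 - (p.1 / graphSlope p.2) ^ 2 := by
      rw [sub_pos, ← sq_abs]; nlinarith [abs_nonneg (p.1 / graphSlope p.2)]
    rw [← lintegral_indicator_one (measurableSet_ballSection _),
      ← lintegral_indicator_one (measurableSet_ballSection _),
      lintegral_comp_add_smul _ (Real.sqrt_pos.2 h1) (sectionCenter p)]
    simp only [Module.finrank_fin_fun]
    congr 1
    refine lintegral_congr fun w => ?_
    by_cases hw : w ∈ ballSection ((0 : ℝ), p.2)
    · rw [Set.indicator_of_mem hw, Set.indicator_of_mem ((mem_ballSection_smul p hp w).2 hw)]; rfl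
    · rw [Set.indicator_of_notMem hw,
        Set.indicator_of_notMem fun h => hw ((mem_ballSection_smul p hp w).1 h)]
  · rw [capWeight_eq_zero hm hp, ENNReal.ofReal_zero, zero_mul]
    have : Nonempty (Fin m) := ⟨⟨0, Nat.pos_of_ne_zero hm⟩⟩
    exact measure_mono_null (ballSection_subset p hp) (measure_singleton _)

lemma baseDet_add_smul (x : Fin m → ℝ) (c : ℝ) (z : Fin (m + 1) → Fin m → ℝ) :
    baseDet (fun i => x + c • z i) = c ^ m * baseDet z := by
  change affDet _ = _ * affDet _
  rw [affDet_eq, affDet_eq]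
  have := Matrix.det_smul (Matrix.of fun i j : Fin m => z i.succ j - z 0 j) c
  rw [Fintype.card_fin] at this
  rw [← this]
  congr 1
  ext i j
  simp
  ring

lemma baseDet_const (hm : m ≠ 0) (x : Fin m → ℝ) : baseDet (fun _ => x) = 0 := by
  have := baseDet_add_smul x 0 (fun _ => x)
  simpa [hm] using this

lemma graphDensity_unitBall (hm : m ≠ 0) (p : Pt m) :
    graphDensity (unitBall m) p = ENNReal.ofReal (capWeight (m * (m + 3)) (p.1 / graphSlope p.2)) *
      graphDensity (unitBall m) ((0 : ℝ), p.2) := by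
  change ∫⁻ z in powSet (m + 1) (ballSection p), ENNReal.ofReal (baseDet z ^ 2)
    = _ * ∫⁻ z in powSet (m + 1) (ballSection ((0 : ℝ), p.2)), ENNReal.ofReal (baseDet z ^ 2)
  have hms (p : Pt m) := powSet_measurableSet (n := m + 1) (measurableSet_ballSection p)
  rcases lt_or_ge |p.1 / graphSlope p.2| 1 with hp | hp
  · have h1 : 0 < 1 - (p.1 / graphSlope p.2) ^ 2 := by
      rw [sub_pos, ← sq_abs]; nlinarith [abs_nonneg (p.1 / graphSlope p.2)]
    have hc := Real.sqrt_pos.2 h1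
    rw [← lintegral_indicator (hms _), ← lintegral_indicator (hms _),
      lintegral_comp_add_smul _ hc (fun _ => sectionCenter p)]
    have hf : Module.finrank ℝ (Fin (m + 1) → Fin m → ℝ) = (m + 1) * m := by
      rw [Module.finrank_pi_fintype]; simp
    rw [hf, capWeight, show m * (m + 3) = (m + 1) * m + 2 * m by ring, pow_add,
      ENNReal.ofReal_mul (by positivity), mul_assoc]
    congr 1
    rw [← lintegral_const_mul' _ _ ENNReal.ofReal_ne_top]
    refine lintegral_congr fun z => ?_
    have hz : (fun _ => sectionCenter p) + √(1 - (p.1 / graphSlope p.2) ^ 2) • z ∈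
        powSet (m + 1) (ballSection p) ↔ z ∈ powSet (m + 1) (ballSection ((0 : ℝ), p.2)) := by
      simp only [Set.mem_univ_pi, Pi.add_apply, Pi.smul_apply, mem_ballSection_smul p hp]
    have hd := baseDet_add_smul (sectionCenter p) (√(1 - (p.1 / graphSlope p.2) ^ 2)) z
    by_cases h : z ∈ powSet (m + 1) (ballSection ((0 : ℝ), p.2))
    · rw [Set.indicator_of_mem h, Set.indicator_of_mem (hz.2 h),
        ← ENNReal.ofReal_mul (by positivity)]
      congr 1
      rw [mul_comm 2 m, pow_mul, ← mul_pow, ← hd]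
      rfl
    · rw [Set.indicator_of_notMem h, Set.indicator_of_notMem fun h' => h (hz.1 h'), mul_zero]
  · rw [capWeight_eq_zero (by positivity) hp, ENNReal.ofReal_zero, zero_mul,
      setLIntegral_congr_fun (g := fun _ => 0) (hms p), lintegral_zero]
    intro z hz
    have : z = fun _ => sectionCenter p := by
      ext i : 1
      exact ballSection_subset p hp (hz i (Set.mem_univ i))
    simp only [this, baseDet_const hm]
    simp

lemma lintegral_pt_symm {f : Pt m → ENNReal} (hf : Measurable f) :
    ∫⁻ x, f x = ∫⁻ z : Fin m → ℝ, ∫⁻ t : ℝ, f (t, z) :=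
  lintegral_prod_symm _ hf.aemeasurable

lemma lintegral_unitBall_affine (hm : m ≠ 0) (b : Fin m → ℝ) (φ : ℝ → ENNReal)
    (hφ : Measurable φ) :
    ∫⁻ y in unitBall m, φ (y.1 - b ⬝ᵥ y.2) = volume (ballSection ((0 : ℝ), b)) *
      ∫⁻ τ, ENNReal.ofReal (capWeight m (τ / graphSlope b)) * φ τ := by
  have hd : Measurable fun z : Fin m → ℝ => b ⬝ᵥ z := by unfold dotProduct; fun_prop
  have hF : Measurable fun y : Pt m => (unitBall m).indicator (fun y => φ (y.1 - b ⬝ᵥ y.2)) y :=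
    (hφ.comp (measurable_fst.sub (hd.comp measurable_snd))).indicator measurableSet_unitBall
  rw [← lintegral_indicator measurableSet_unitBall, lintegral_pt_symm hF]
  have h1 (z : Fin m → ℝ) :
      ∫⁻ t, (unitBall m).indicator (fun y : Pt m => φ (y.1 - b ⬝ᵥ y.2)) (t, z)
      = ∫⁻ τ, (ballSection (τ, b)).indicator (fun _ => φ τ) z := by
    rw [← lintegral_add_right_eq_self _ (b ⬝ᵥ z)]
    refine lintegral_congr fun τ => ?_
    by_cases h : z ∈ ballSection (τ, b)
    · have h' : ((τ + b ⬝ᵥ z, z) : Pt m) ∈ unitBall m := h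
      rw [Set.indicator_of_mem h', Set.indicator_of_mem h]
      simp
    · have h' : ((τ + b ⬝ᵥ z, z) : Pt m) ∉ unitBall m := h
      rw [Set.indicator_of_notMem h', Set.indicator_of_notMem h]
  simp_rw [h1]
  rw [lintegral_lintegral_swap]
  · rw [← lintegral_const_mul]
    · refine lintegral_congr fun τ => ?_
      rw [lintegral_indicator_const (measurableSet_ballSection _), volume_ballSection hm]
      ring
    · refine Measurable.mul ?_ hφ
      exact ((continuous_capWeight m).measurable.comp (measurable_id.div_const _)).ennreal_ofReal
  · refine Measurable.aemeasurable ?_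
    have hms : MeasurableSet {x : (Fin m → ℝ) × ℝ | x.1 ∈ ballSection (x.2, b)} := by
      have : Measurable fun x : (Fin m → ℝ) × ℝ => ((x.2 + b ⬝ᵥ x.1, x.1) : Pt m) :=
        (measurable_snd.add (hd.comp measurable_fst)).prodMk measurable_fst
      exact this measurableSet_unitBall
    exact (hφ.comp measurable_snd).indicator hms

lemma lintegral_comp_mul (f : ℝ → ENNReal) {s : ℝ} (hs : 0 < s) :
    ∫⁻ a, f a = ENNReal.ofReal s * ∫⁻ a, f (s * a) := by
  have := lintegral_comp_add_smul f hs 0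
  simpa using this

/-- The factor depending only on the direction of the hyperplane. -/
noncomputable def directionWeight (b : Fin m → ℝ) : ENNReal :=
  graphDensity (unitBall m) ((0 : ℝ), b) * volume (ballSection ((0 : ℝ), b)) *
    ENNReal.ofReal (graphSlope b) ^ 3

lemma measurable_directionWeight : Measurable (directionWeight (m := m)) := by
  have hd : Measurable fun b : Fin m → ℝ => ((0 : ℝ), b) := by fun_prop
  have h1 := (measurable_graphDensity (measurableSet_unitBall (m := m))).comp hd
  have hs : MeasurableSet {x : (Fin m → ℝ) × (Fin m → ℝ) | x.2 ∈ ballSection ((0 : ℝ), x.1)} := by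
    have : Measurable fun x : (Fin m → ℝ) × (Fin m → ℝ) => ((0 + x.1 ⬝ᵥ x.2, x.2) : Pt m) := by
      unfold dotProduct; fun_prop
    exact this measurableSet_unitBall
  have h2 : Measurable fun b : Fin m → ℝ => volume (ballSection ((0 : ℝ), b)) :=
    measurable_measure_prodMk_left hs
  refine (h1.mul h2).mul (Measurable.pow_const ?_ 3)
  unfold graphSlope dotProduct
  fun_prop

lemma volume_unitBall (hm : m ≠ 0) (b : Fin m → ℝ) :
    volume (unitBall m) = volume (ballSection ((0 : ℝ), b)) *
      (ENNReal.ofReal (graphSlope b) * ∫⁻ q, ENNReal.ofReal (capWeight m q)) := by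
  have h := lintegral_unitBall_affine hm b (fun _ => 1) measurable_const
  rw [setLIntegral_const, one_mul] at h
  rw [h, lintegral_comp_mul _ (graphSlope_pos b)]
  simp only [mul_one, mul_div_cancel_left₀ _ (graphSlope_pos b).ne']

lemma lintegral_unitBall_abs (hm : m ≠ 0) (b : Fin m → ℝ) (p : ℝ) :
    ∫⁻ y in unitBall m, ENNReal.ofReal |y.1 - (graphSlope b * p + b ⬝ᵥ y.2)| =
      volume (ballSection ((0 : ℝ), b)) * (ENNReal.ofReal (graphSlope b) ^ 2 *
        ∫⁻ q, ENNReal.ofReal (capWeight m q) * ENNReal.ofReal |q - p|) := by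
  have h := lintegral_unitBall_affine hm b (fun t => ENNReal.ofReal |t - graphSlope b * p|)
    (by fun_prop)
  have hs := graphSlope_pos b
  rw [lintegral_comp_mul _ hs] at h
  have e (q : ℝ) : ENNReal.ofReal |graphSlope b * q - graphSlope b * p|
      = ENNReal.ofReal (graphSlope b) * ENNReal.ofReal |q - p| := by
    rw [← mul_sub, abs_mul, abs_of_pos hs, ENNReal.ofReal_mul hs.le]
  simp only [mul_div_cancel_left₀ _ hs.ne', e, mul_left_comm _ (ENNReal.ofReal (graphSlope b))] at h
  rw [lintegral_const_mul' _ _ ENNReal.ofReal_ne_top] at h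
  rw [sq, mul_assoc, mul_left_comm, ← h]
  refine lintegral_congr fun y => ?_
  congr 2
  ring

lemma simplexIntegral_unitBall (hm : m ≠ 0) :
    simplexIntegral (unitBall m) = (∫⁻ b : Fin m → ℝ, directionWeight b) *
      ∫⁻ q, ENNReal.ofReal (capWeight m q) *
        ∫⁻ p, ENNReal.ofReal (capWeight (m * (m + 3)) p) * ENNReal.ofReal |q - p| := by
  have hD := measurable_graphDensity (measurableSet_unitBall (m := m))
  have hF : Measurable fun x : Pt m × Pt m => ENNReal.ofReal |x.1.1 - (x.2.1 + x.2.2 ⬝ᵥ x.1.2)|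
      * graphDensity (unitBall m) x.2 := by
    refine Measurable.mul ?_ (hD.comp measurable_snd)
    unfold dotProduct; fun_prop
  have hG : Measurable fun x : ℝ × ℝ => ENNReal.ofReal (capWeight m x.1) *
      (ENNReal.ofReal (capWeight (m * (m + 3)) x.2) * ENNReal.ofReal |x.1 - x.2|) := by
    fun_prop
  rw [simplexIntegral_eq]
  simp only [coneIntegral_eq measurableSet_unitBall]
  rw [lintegral_lintegral_swap hF.aemeasurable, lintegral_pt_symm
    (Measurable.lintegral_prod_left' hF), ← lintegral_mul_const _ measurable_directionWeight]
  refine lintegral_congr fun b => ?_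
  rw [lintegral_comp_mul _ (graphSlope_pos b)]
  have h1 (p : ℝ) : ∫⁻ y in unitBall m, ENNReal.ofReal |y.1 - (graphSlope b * p + b ⬝ᵥ y.2)|
      * graphDensity (unitBall m) (graphSlope b * p, b) =
      graphDensity (unitBall m) ((0 : ℝ), b) * volume (ballSection ((0 : ℝ), b)) *
        ENNReal.ofReal (graphSlope b) ^ 2 * ∫⁻ q, ENNReal.ofReal (capWeight m q) *
          (ENNReal.ofReal (capWeight (m * (m + 3)) p) * ENNReal.ofReal |q - p|) := by
    rw [lintegral_mul_const, lintegral_unitBall_abs hm, graphDensity_unitBall hm,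
      mul_div_cancel_left₀ _ (graphSlope_pos b).ne']
    · simp_rw [mul_left_comm _ (ENNReal.ofReal (capWeight (m * (m + 3)) p))]
      rw [lintegral_const_mul' _ _ ENNReal.ofReal_ne_top]
      ring
    · unfold dotProduct; fun_prop
  simp only [h1]
  rw [lintegral_const_mul _ (Measurable.lintegral_prod_left' hG), lintegral_lintegral_swap
    (f := fun p q => ENNReal.ofReal (capWeight m q) *
      (ENNReal.ofReal (capWeight (m * (m + 3)) p) * ENNReal.ofReal |q - p|))
    (hG.comp measurable_swap).aemeasurable]
  simp_rw [lintegral_const_mul' (ENNReal.ofReal (capWeight m _)) _ ENNReal.ofReal_ne_top]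
  rw [directionWeight]
  ring

lemma volume_mul_coneIntegral_unitBall (hm : m ≠ 0) :
    volume (unitBall m) * coneIntegral (unitBall m) 0 = (∫⁻ b : Fin m → ℝ, directionWeight b) *
      ((∫⁻ p, ENNReal.ofReal (capWeight (m * (m + 3)) p) * ENNReal.ofReal |p|) *
        ∫⁻ q, ENNReal.ofReal (capWeight m q)) := by
  have hD := measurable_graphDensity (measurableSet_unitBall (m := m))
  have hF : Measurable fun x : Pt m => ENNReal.ofReal |x.1| * graphDensity (unitBall m) x :=
    Measurable.mul (by fun_prop) hD
  rw [coneIntegral_eq measurableSet_unitBall]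
  simp only [Prod.fst_zero, Prod.snd_zero, dotProduct_zero, add_zero, zero_sub, abs_neg]
  rw [← lintegral_const_mul _ hF, lintegral_pt_symm (hF.const_mul _),
    ← lintegral_mul_const _ measurable_directionWeight]
  refine lintegral_congr fun b => ?_
  have hs := graphSlope_pos b
  rw [lintegral_comp_mul _ hs]
  have h1 (p : ℝ) : volume (unitBall m) * (ENNReal.ofReal |graphSlope b * p|
      * graphDensity (unitBall m) (graphSlope b * p, b)) =
      graphDensity (unitBall m) ((0 : ℝ), b) * volume (ballSection ((0 : ℝ), b)) *
        ENNReal.ofReal (graphSlope b) ^ 2 * (∫⁻ q, ENNReal.ofReal (capWeight m q)) *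
          (ENNReal.ofReal (capWeight (m * (m + 3)) p) * ENNReal.ofReal |p|) := by
    rw [volume_unitBall hm b, graphDensity_unitBall hm,
      mul_div_cancel_left₀ _ (graphSlope_pos b).ne', abs_mul, ENNReal.ofReal_mul (abs_nonneg _),
      abs_of_pos hs]
    ring
  simp only [h1]
  rw [lintegral_const_mul _ (by fun_prop), directionWeight]
  ring

lemma two_mul_volume_mul_coneIntegral_lt (hm : 3 ≤ m) :
    2 * (volume (unitBall m) * coneIntegral (unitBall m) 0) < simplexIntegral (unitBall m) := by
  have h0 := simplexIntegral_ne_zero (A := unitBall m) volume_unitBall_ne_zero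
  have h1 := simplexIntegral_ne_top (isCompact_unitBall (m := m))
  have key := lintegral_capWeight_comparison hm
  rw [volume_mul_coneIntegral_unitBall (by lia), simplexIntegral_unitBall (by lia)] at *
  rw [mul_left_comm]
  have hT : (∫⁻ b : Fin m → ℝ, directionWeight b) ≠ 0 := left_ne_zero_of_mul h0
  refine ENNReal.mul_lt_mul_right hT (fun h => h1 ?_) key
  rw [h, ENNReal.top_mul (right_ne_zero_of_mul h0)]

/-- The part of a set strictly above the base hyperplane. -/
def upperHalf (A : Set (Pt m)) : Set (Pt m) := A ∩ {x | 0 < x.1}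

lemma measurableSet_upperHalf {A : Set (Pt m)} (hA : MeasurableSet A) :
    MeasurableSet (upperHalf A) :=
  hA.inter (measurableSet_lt measurable_const measurable_fst)

lemma neg_mem_unitBall {x : Pt m} : -x ∈ unitBall m ↔ x ∈ unitBall m := by
  simp [unitBall]

lemma measurePreserving_neg_pt : MeasurePreserving fun x : Pt m => -x :=
  (Measure.measurePreserving_neg (volume : Measure ℝ)).prod
    (Measure.measurePreserving_neg (volume : Measure (Fin m → ℝ)))

lemma two_mul_volume_upperHalf_le :
    2 * volume (upperHalf (unitBall m)) ≤ volume (unitBall m) := by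
  have hm := measurableSet_upperHalf (measurableSet_unitBall (m := m))
  have hd : Disjoint (upperHalf (unitBall m)) (-upperHalf (unitBall m)) := by
    rw [Set.disjoint_left]
    intro x hx hx'
    have h1 : 0 < x.1 := hx.2
    have h2 : 0 < -x.1 := hx'.2
    linarith
  have hv : volume (-upperHalf (unitBall m)) = volume (upperHalf (unitBall m)) :=
    measurePreserving_neg_pt.measure_preimage hm.nullMeasurableSet
  rw [two_mul]
  nth_rewrite 2 [← hv]
  rw [← measure_union hd hm.neg]
  refine measure_mono (Set.union_subset Set.inter_subset_left fun x hx => ?_)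
  exact neg_mem_unitBall.1 hx.1

lemma measurePreserving_units_smul (ε : Fin (m + 1) → ℤˣ) :
    MeasurePreserving (fun (Y : Fin (m + 1) → Pt m) i => ((ε i : ℤ) : ℝ) • Y i) := by
  refine volume_preserving_pi (f := fun i (y : Pt m) => ((ε i : ℤ) : ℝ) • y) fun i => ?_
  rcases Int.units_eq_one_or (ε i) with h | h
  · simpa [h] using! MeasurePreserving.id (volume : Measure (Pt m))
  · simpa [h] using measurePreserving_neg_pt (m := m)

lemma two_pow_mul_coneIntegral_upperHalf_le :
    2 ^ (m + 1) * coneIntegral (upperHalf (unitBall m)) 0 ≤ coneIntegral (unitBall m) 0 := by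
  have hH := powSet_measurableSet (n := m + 1)
    (measurableSet_upperHalf (measurableSet_unitBall (m := m)))
  have hg : Measurable fun Y : Fin (m + 1) → Pt m => ENNReal.ofReal |coneDet Y| :=
    continuous_coneDet.abs.measurable.ennreal_ofReal
  let φ (ε : Fin (m + 1) → ℤˣ) (Y : Fin (m + 1) → Pt m) : Fin (m + 1) → Pt m :=
    fun i => ((ε i : ℤ) : ℝ) • Y i
  let S (ε : Fin (m + 1) → ℤˣ) : Set (Fin (m + 1) → Pt m) :=
    φ ε ⁻¹' powSet (m + 1) (upperHalf (unitBall m))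
  have habs (u : ℤˣ) : |((u : ℤ) : ℝ)| = 1 := by
    rcases Int.units_eq_one_or u with h | h <;> simp [h]
  have hS (ε) : ∫⁻ Y in S ε, ENNReal.ofReal |coneDet Y| =
      ∫⁻ Y in powSet (m + 1) (upperHalf (unitBall m)), ENNReal.ofReal |coneDet Y| := by
    rw [← (measurePreserving_units_smul ε).setLIntegral_comp_preimage hH hg]
    simp only [abs_coneDet_smul _ fun i => habs (ε i)]
    rfl
  have hdisj : Pairwise (Function.onFun Disjoint S) := by
    intro ε ε' hne
    rw [Function.onFun, Set.disjoint_left]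
    intro Y hY hY'
    refine hne (funext fun i => ?_)
    have h1 : 0 < ((ε i : ℤ) : ℝ) * (Y i).1 := (hY i (Set.mem_univ i)).2
    have h2 : 0 < ((ε' i : ℤ) : ℝ) * (Y i).1 := (hY' i (Set.mem_univ i)).2
    rcases Int.units_eq_one_or (ε i) with h | h <;>
      rcases Int.units_eq_one_or (ε' i) with h' | h' <;> simp only [h, h'] at h1 h2 ⊢ <;>
      (push_cast at h1 h2; linarith)
  have hsub : ⋃ ε, S ε ⊆ powSet (m + 1) (unitBall m) := by
    refine Set.iUnion_subset fun ε Y hY i _ => ?_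
    have h1 : ((ε i : ℤ) : ℝ) • Y i ∈ unitBall m := (hY i (Set.mem_univ i)).1
    rcases Int.units_eq_one_or (ε i) with h | h
    · simpa [h] using h1
    · simpa [h, neg_mem_unitBall] using h1
  rw [coneIntegral_zero, coneIntegral_zero]
  refine le_trans (le_of_eq ?_) (lintegral_mono_set hsub)
  rw [lintegral_iUnion (fun ε => (measurePreserving_units_smul ε).measurable hH) hdisj,
    tsum_fintype]
  rw [Finset.sum_congr rfl fun ε _ => hS ε, Finset.sum_const, nsmul_eq_mul]
  simp

lemma volume_height_eq_zero : volume {x : Pt m | x.1 = 0} = 0 := by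
  have : {x : Pt m | x.1 = 0} = ({0} : Set ℝ) ×ˢ Set.univ := by ext; simp
  rw [this, Measure.volume_eq_prod, Measure.prod_prod]
  simp

lemma simplexIntegral_mono_ae {A B : Set (Pt m)} (h : A ≤ᵐ[volume] B) :
    simplexIntegral A ≤ simplexIntegral B :=
  lintegral_mono_set' (Measure.ae_le_set_pi fun _ _ => h)

lemma coneIntegral_mono_ae {A B : Set (Pt m)} (h : A ≤ᵐ[volume] B) (y : Pt m) :
    coneIntegral A y ≤ coneIntegral B y :=
  lintegral_mono_set' (Measure.ae_le_set_pi fun _ _ => h)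

lemma lintegral_powSet_comp {A : Set (Pt m)} (hA : MeasurableSet A) {φ : Pt m → Pt m}
    (hφ : MeasurePreserving φ) {n : ℕ} {F : (Fin n → Pt m) → ENNReal} (hF : Measurable F) :
    ∫⁻ X in powSet n A, F X = ∫⁻ X in powSet n (φ ⁻¹' A), F fun i => φ (X i) :=
  ((volume_preserving_pi fun _ => hφ).setLIntegral_comp_preimage (powSet_measurableSet hA) hF).symm

lemma measurePreserving_shear {f : (Fin m → ℝ) → ℝ} (hf : Measurable f) :
    MeasurePreserving fun x : Pt m => ((x.1 + f x.2, x.2) : Pt m) := by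
  have hφ : Measurable fun x : Pt m => ((x.1 + f x.2, x.2) : Pt m) :=
    (measurable_fst.add (hf.comp measurable_snd)).prodMk measurable_snd
  refine ⟨hφ, Measure.ext_of_lintegral _ fun h hh => ?_⟩
  rw [lintegral_map hh hφ, lintegral_pt_symm hh]
  refine (lintegral_pt_symm (hh.comp hφ)).trans ?_
  exact lintegral_congr fun z => lintegral_add_right_eq_self (fun t => h (t, z)) (f z)

lemma measurePreserving_reflect : MeasurePreserving fun x : Pt m => ((-x.1, x.2) : Pt m) :=
  (Measure.measurePreserving_neg (volume : Measure ℝ)).prod (MeasurePreserving.id _)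

lemma measurePreserving_stretch {s : ℝ} (hs : 0 < s) :
    MeasurePreserving (fun x : Pt m => ((s * x.1, x.2) : Pt m)) volume
      (ENNReal.ofReal s⁻¹ • volume) := by
  have h : MeasurePreserving (fun t : ℝ => s * t) volume (ENNReal.ofReal s⁻¹ • volume) :=
    ⟨measurable_const_mul s, by rw [Real.map_volume_mul_left hs.ne', abs_of_pos (inv_pos.2 hs)]⟩
  have h2 := h.prod (MeasurePreserving.id (volume : Measure (Fin m → ℝ)))
  rw [Measure.prod_smul_left] at h2
  exact h2

lemma pi_smul_measure {E : Type*} [MeasureSpace E] [SigmaFinite (volume : Measure E)] (n : ℕ)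
    {c : ENNReal} (hc : c ≠ ⊤) :
    Measure.pi (fun _ : Fin n => c • (volume : Measure E)) = c ^ n • volume := by
  have : SigmaFinite (c • (volume : Measure E)) := by
    lift c to NNReal using hc
    exact inferInstanceAs (SigmaFinite (c • (volume : Measure E)))
  refine (Measure.pi_eq fun s _ => ?_)
  simp [volume_pi_pi, Finset.prod_mul_distrib]

lemma simplexIntegral_stretch {A : Set (Pt m)} (hA : MeasurableSet A) {s : ℝ}
    (hs : 0 < s) :
    ENNReal.ofReal s * simplexIntegral ((fun x : Pt m => ((s * x.1, x.2) : Pt m)) ⁻¹' A) =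
      ENNReal.ofReal s⁻¹ ^ (m + 2) * simplexIntegral A := by
  have : SigmaFinite (ENNReal.ofReal s⁻¹ • (volume : Measure (Pt m))) := by
    exact inferInstanceAs (SigmaFinite (s⁻¹.toNNReal • (volume : Measure (Pt m))))
  have h := measurePreserving_pi (fun _ : Fin (m + 2) => (volume : Measure (Pt m)))
    (fun _ => ENNReal.ofReal s⁻¹ • volume) fun _ => measurePreserving_stretch hs
  rw [pi_smul_measure _ ENNReal.ofReal_ne_top] at h
  have h2 := h.setLIntegral_comp_preimage (powSet_measurableSet hA)
    (continuous_simplexDet (m := m)).abs.measurable.ennreal_ofReal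
  rw [Measure.restrict_smul, lintegral_smul_measure, smul_eq_mul] at h2
  refine Eq.trans ?_ h2
  rw [simplexIntegral, ← lintegral_const_mul' _ _ ENNReal.ofReal_ne_top]
  simp only [simplexDet_smul_height, abs_mul, abs_of_pos hs, ENNReal.ofReal_mul hs.le]
  rfl

lemma simplexIntegral_unitBall_le :
    simplexIntegral (unitBall m) ≤ 2 ^ (m + 3) * simplexIntegral (upperHalf (unitBall m)) := by
  let H : Set (Pt m) := unitBall m ∩ {x | 0 ≤ x.1}
  let S : Set (Pt m) := (fun x : Pt m => ((2 * x.1, x.2) : Pt m)) ⁻¹' unitBall m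
  let f (z : Fin m → ℝ) : ℝ := √(1 - z ⬝ᵥ z) / 2
  have hf : Measurable f := by unfold f dotProduct; fun_prop
  have hHm : MeasurableSet H :=
    measurableSet_unitBall.inter (measurableSet_le measurable_const measurable_fst)
  have hSm : MeasurableSet S := by
    have : Measurable fun x : Pt m => ((2 * x.1, x.2) : Pt m) := by fun_prop
    exact this measurableSet_unitBall
  have hF : Measurable fun X : Fin (m + 2) → Pt m => ENNReal.ofReal |simplexDet X| :=
    continuous_simplexDet.abs.measurable.ennreal_ofReal
  have hSH : S ⊆ (fun x : Pt m => ((x.1 + f x.2, x.2) : Pt m)) ⁻¹' H := by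
    intro x hx
    have hx' : (2 * x.1) ^ 2 + x.2 ⬝ᵥ x.2 ≤ 1 := hx
    have h0 : 0 ≤ 1 - x.2 ⬝ᵥ x.2 := by nlinarith [sq_nonneg (2 * x.1)]
    have h1 := Real.sq_sqrt h0
    have h2 := abs_le_of_sq_le_sq' (a := 2 * x.1) (b := √(1 - x.2 ⬝ᵥ x.2)) (by linarith)
      (Real.sqrt_nonneg _)
    refine ⟨?_, ?_⟩
    · change (x.1 + √(1 - x.2 ⬝ᵥ x.2) / 2) ^ 2 + x.2 ⬝ᵥ x.2 ≤ 1
      nlinarith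
    · change 0 ≤ x.1 + √(1 - x.2 ⬝ᵥ x.2) / 2
      linarith
  have hrefl : (fun x : Pt m => ((-x.1, x.2) : Pt m)) ⁻¹' S = S := by
    ext x
    simp [S, unitBall]
  let J : ENNReal := ∫⁻ X in powSet (m + 2) S,
    ENNReal.ofReal |simplexDet fun i => (((X i).1 + f (X i).2, (X i).2) : Pt m)|
  have hφ := measurePreserving_shear hf
  have hφn : Measurable fun (X : Fin (m + 2) → Pt m) i =>
      (((X i).1 + f (X i).2, (X i).2) : Pt m) :=
    measurable_pi_lambda _ fun i => hφ.measurable.comp (measurable_pi_apply i)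
  have h1 : J ≤ simplexIntegral H := by
    rw [simplexIntegral, lintegral_powSet_comp hHm hφ hF]
    exact lintegral_mono_set (Set.pi_mono fun _ _ => hSH)
  have h2 : J = ∫⁻ X in powSet (m + 2) S,
      ENNReal.ofReal |simplexDet fun i => ((-(X i).1 + f (X i).2, (X i).2) : Pt m)| := by
    have := lintegral_powSet_comp hSm measurePreserving_reflect (hF.comp hφn)
    rw [hrefl] at this
    exact this
  have h3 : 2 * simplexIntegral S ≤ J + J := by
    nth_rewrite 2 [h2]
    rw [simplexIntegral, ← lintegral_const_mul _ hF]
    refine le_of_le_of_eq ?_ (lintegral_add_left (hF.comp hφn) _)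
    refine lintegral_mono fun X => ?_
    have := ENNReal.ofReal_le_ofReal (two_abs_simplexDet_le f X)
    rwa [ENNReal.ofReal_mul zero_le_two, ENNReal.ofReal_add (abs_nonneg _) (abs_nonneg _),
      ENNReal.ofReal_ofNat] at this
  have h4 : simplexIntegral H ≤ simplexIntegral (upperHalf (unitBall m)) := by
    refine simplexIntegral_mono_ae ?_
    have : ∀ᵐ x : Pt m, x.1 ≠ 0 := by
      rw [ae_iff]; simpa using volume_height_eq_zero
    filter_upwards [this] with x hx hxH
    exact ⟨hxH.1, lt_of_le_of_ne hxH.2 hx.symm⟩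
  have h5 := simplexIntegral_stretch (measurableSet_unitBall (m := m)) zero_lt_two
  rw [ENNReal.ofReal_ofNat, ENNReal.ofReal_inv_of_pos zero_lt_two, ENNReal.ofReal_ofNat] at h5
  have h6 : simplexIntegral (unitBall m) = 2 ^ (m + 2) * (2 * simplexIntegral S) := by
    rw [h5, ← mul_assoc, ← mul_pow, ENNReal.mul_inv_cancel two_ne_zero ENNReal.ofNat_ne_top,
      one_pow, one_mul]
  rw [← two_mul] at h3
  rw [h6, pow_succ 2 (m + 2), mul_assoc]
  exact mul_le_mul_right (h3.trans (mul_le_mul_right (h1.trans h4) _)) _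

lemma volume_mul_coneIntegral_upperHalf_lt (hm : 3 ≤ m) :
    volume (upperHalf (unitBall m)) * coneIntegral (upperHalf (unitBall m)) 0 <
      simplexIntegral (upperHalf (unitBall m)) := by
  have h := two_mul_volume_mul_coneIntegral_lt hm
  have h1 : (2 ^ (m + 3) : ENNReal) ≠ 0 := by simp
  have h2 : (2 ^ (m + 3) : ENNReal) ≠ ⊤ := by simp
  rw [← ENNReal.mul_lt_mul_iff_right h1 h2]
  calc 2 ^ (m + 3) *
        (volume (upperHalf (unitBall m)) * coneIntegral (upperHalf (unitBall m)) 0)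
      = 2 * ((2 * volume (upperHalf (unitBall m))) *
        (2 ^ (m + 1) * coneIntegral (upperHalf (unitBall m)) 0)) := by ring
    _ ≤ 2 * (volume (unitBall m) * coneIntegral (unitBall m) 0) := by
      gcongr
      · exact two_mul_volume_upperHalf_le
      · exact two_pow_mul_coneIntegral_upperHalf_le
    _ < simplexIntegral (unitBall m) := h
    _ ≤ _ := simplexIntegral_unitBall_le

/-- The part of the unit ball inside a convex cone around the first axis. -/
def ballCone (m : ℕ) (η : ℝ) : Set (Pt m) := unitBall m ∩ {x | η * ‖x.2‖ ≤ x.1}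

lemma isClosed_ballCone (η : ℝ) : IsClosed (ballCone m η) :=
  isClosed_unitBall.inter (isClosed_le (by fun_prop) (by fun_prop))

lemma isCompact_ballCone (η : ℝ) : IsCompact (ballCone m η) :=
  isCompact_unitBall.of_isClosed_subset (isClosed_ballCone η) Set.inter_subset_left

lemma convex_unitBall : Convex ℝ (unitBall m) := by
  intro x hx y hy a b ha hb hab
  have hx' : x.1 ^ 2 + x.2 ⬝ᵥ x.2 ≤ 1 := hx
  have hy' : y.1 ^ 2 + y.2 ⬝ᵥ y.2 ≤ 1 := hy
  change (a * x.1 + b * y.1) ^ 2 + (a • x.2 + b • y.2) ⬝ᵥ (a • x.2 + b • y.2) ≤ 1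
  have h := dotProduct_self_nonneg_real (x.2 - y.2)
  simp only [sub_dotProduct, dotProduct_sub, add_dotProduct, dotProduct_add, smul_dotProduct,
    dotProduct_smul, smul_eq_mul, dotProduct_comm y.2 x.2] at h ⊢
  obtain rfl : b = 1 - a := by linarith
  have hab' := mul_nonneg ha hb
  nlinarith [mul_nonneg hab' h, mul_nonneg hab' (sq_nonneg (x.1 - y.1))]

lemma convex_ballCone {η : ℝ} (hη : 0 ≤ η) : Convex ℝ (ballCone m η) := by
  refine convex_unitBall.inter fun x hx y hy a b ha hb _ => ?_
  have hx' : η * ‖x.2‖ ≤ x.1 := hx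
  have hy' : η * ‖y.2‖ ≤ y.1 := hy
  change η * ‖a • x.2 + b • y.2‖ ≤ a * x.1 + b * y.1
  have h := norm_add_le (a • x.2) (b • y.2)
  rw [norm_smul_of_nonneg ha, norm_smul_of_nonneg hb] at h
  nlinarith [mul_le_mul_of_nonneg_left h hη, mul_le_mul_of_nonneg_left hx' ha,
    mul_le_mul_of_nonneg_left hy' hb]

lemma ballCone_anti {η η' : ℝ} (h : η ≤ η') : ballCone m η' ⊆ ballCone m η :=
  fun _ hx => ⟨hx.1, (mul_le_mul_of_nonneg_right h (norm_nonneg _)).trans hx.2⟩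

lemma ballCone_ae_le {η : ℝ} (hη : 0 ≤ η) : ballCone m η ≤ᵐ[volume] upperHalf (unitBall m) := by
  have : ∀ᵐ x : Pt m, x.1 ≠ 0 := by
    rw [ae_iff]; simpa using volume_height_eq_zero
  filter_upwards [this] with x hx hxH
  exact ⟨hxH.1, lt_of_le_of_ne ((mul_nonneg hη (norm_nonneg _)).trans hxH.2) hx.symm⟩

lemma upperHalf_subset_iUnion :
    upperHalf (unitBall m) ⊆ ⋃ k : ℕ, ballCone m (1 / ((k : ℝ) + 1)) := by
  intro x hx
  have h0 : 0 < x.1 := hx.2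
  obtain ⟨k, hk⟩ := exists_nat_gt (‖x.2‖ / x.1)
  refine Set.mem_iUnion.2 ⟨k, hx.1, ?_⟩
  rw [div_lt_iff₀ h0] at hk
  change 1 / ((k : ℝ) + 1) * ‖x.2‖ ≤ x.1
  rw [one_div_mul_eq_div, div_le_iff₀ (by positivity)]
  nlinarith

lemma exists_ballCone (hm : 3 ≤ m) : ∃ η : ℝ, 0 < η ∧
    volume (ballCone m η) * coneIntegral (ballCone m η) 0 < simplexIntegral (ballCone m η) := by
  have hmono : Monotone fun k : ℕ => ballCone m (1 / ((k : ℝ) + 1)) := fun k l hkl =>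
    ballCone_anti (one_div_le_one_div_of_le (by positivity) (by gcongr))
  have hsup : simplexIntegral (⋃ k : ℕ, ballCone m (1 / ((k : ℝ) + 1))) =
      ⨆ k : ℕ, simplexIntegral (ballCone m (1 / ((k : ℝ) + 1))) := by
    have h := Set.iUnion_univ_pi_of_monotone (ι := Fin (m + 2)) fun _ => hmono
    unfold simplexIntegral powSet
    rw [← h, setLIntegral_iUnion_of_directed]
    exact directed_of_isDirected_le fun k l hkl => Set.pi_mono fun _ _ => hmono hkl
  have hlt := (volume_mul_coneIntegral_upperHalf_lt hm).trans_le
    (lintegral_mono_set (Set.pi_mono fun _ _ => upperHalf_subset_iUnion))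
  change _ < simplexIntegral _ at hlt
  rw [hsup, lt_iSup_iff] at hlt
  obtain ⟨k, hk⟩ := hlt
  have hη : (0 : ℝ) < 1 / ((k : ℝ) + 1) := by positivity
  refine ⟨_, hη, lt_of_le_of_lt ?_ hk⟩
  exact mul_le_mul' (measure_mono_ae (ballCone_ae_le hη.le))
    (coneIntegral_mono_ae (ballCone_ae_le hη.le) 0)

lemma continuous_coneIntegral {A : Set (Pt m)} (hA : IsCompact A) :
    Continuous (coneIntegral A) := by
  have hc : IsCompact (powSet (m + 1) A) := isCompact_univ_pi fun _ => hA
  have h := continuous_parametric_integral_of_continuous (μ := volume)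
    (f := fun (y : Pt m) (Y : Fin (m + 1) → Pt m) =>
      |simplexDet (Fin.cons y Y : Fin (m + 2) → Pt m)|) continuous_abs_simplexDet_cons hc
  convert ENNReal.continuous_ofReal.comp h using 1
  ext y
  rw [Function.comp_apply, ofReal_integral_eq_lintegral_ofReal]
  · rfl
  · have hy : Continuous fun Y : Fin (m + 1) → Pt m =>
        |simplexDet (Fin.cons y Y : Fin (m + 2) → Pt m)| :=
      continuous_abs_simplexDet_cons.comp (by fun_prop : Continuous fun Y => (y, Y))
    exact hy.continuousOn.integrableOn_compact hc
  · exact Filter.Eventually.of_forall fun _ => abs_nonneg _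

lemma simplexIntegral_le_add (L K : Set (Pt m)) :
    simplexIntegral L ≤
      simplexIntegral K + (m + 2 : ℕ) * ∫⁻ y in L \ K, coneIntegral L y := by
  have hsub : powSet (m + 2) L ⊆ powSet (m + 2) K ∪
      ⋃ i : Fin (m + 2), Set.univ.pi (i.insertNth (L \ K) fun _ => L : Fin (m + 2) → Set (Pt m)) := by
    intro X hX
    by_cases h : X ∈ powSet (m + 2) K
    · exact Or.inl h
    · simp only [Set.mem_univ_pi, not_forall] at h
      obtain ⟨i, hi⟩ := h
      refine Or.inr (Set.mem_iUnion.2 ⟨i, fun j _ => ?_⟩)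
      rcases Fin.eq_self_or_eq_succAbove i j with rfl | ⟨j, rfl⟩
      · simpa using ⟨hX j (Set.mem_univ j), hi⟩
      · simpa using hX _ (Set.mem_univ _)
  refine (lintegral_mono_set hsub).trans ((lintegral_union_le _ _ _).trans ?_)
  refine add_le_add le_rfl ((lintegral_iUnion_le _ _).trans (le_of_eq ?_))
  rw [tsum_fintype]
  simp only [lintegral_insertNth, Finset.sum_const, nsmul_eq_mul, Finset.card_univ,
    Fintype.card_fin]

lemma mul_one_sub_pow_lt {n : ℕ} (hn : n ≠ 0) {I J a x : ℝ} (hx : 0 < x) (hx1 : x ≤ 1)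
    (ha : 0 ≤ a) (hI : I ≤ J + n * x * a) (hxa : n * x * a < I - a) : I * (1 - x) ^ n < J := by
  have hn' : (0 : ℝ) < n := by positivity
  have h1 : (1 - x) ^ n * (1 + n * x) ≤ 1 := by
    calc (1 - x) ^ n * (1 + n * x) ≤ (1 - x) ^ n * (1 + x) ^ n := by
          have := one_add_mul_le_pow (a := x) (by linarith) n
          gcongr
      _ = (1 - x ^ 2) ^ n := by rw [← mul_pow]; ring
      _ ≤ 1 := pow_le_one₀ (by nlinarith) (by nlinarith)
  have hp : 0 < 1 + n * x := by positivity
  have hnx : 0 < n * x := by positivity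
  have hI0 : 0 < I := by nlinarith [mul_nonneg hnx.le ha]
  refine lt_of_mul_lt_mul_right (a := 1 + n * x) ?_ hp.le
  calc I * (1 - x) ^ n * (1 + n * x) = I * ((1 - x) ^ n * (1 + n * x)) := by ring
    _ ≤ I * 1 := by gcongr
    _ < (I - n * x * a) * (1 + n * x) := by nlinarith [mul_pos hnx (sub_pos.2 hxa)]
    _ ≤ J * (1 + n * x) := by gcongr; linarith

/-- Cutting off a small neighbourhood of a point at which `coneIntegral` is below average
increases the normalized integral. -/
lemma exists_nhds_cut {L : Set (Pt m)} (hL : IsCompact L)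
    (hlt : volume L * coneIntegral L 0 < simplexIntegral L) :
    ∃ U ∈ 𝓝 (0 : Pt m), ∀ K ⊆ L, MeasurableSet K → L \ K ⊆ U → volume (L \ K) ≠ 0 →
      (simplexIntegral L).toReal * (volume K).toReal ^ (m + 2) <
        (simplexIntegral K).toReal * (volume L).toReal ^ (m + 2) := by
  obtain ⟨a, ha, haI⟩ := exists_between hlt
  have hI := simplexIntegral_ne_top hL
  have hv := hL.measure_lt_top (μ := volume) |>.ne
  lift a to NNReal using (haI.trans_le le_top).ne
  by_cases hv0 : volume L = 0
  · exact ⟨Set.univ, Filter.univ_mem, fun K _ _ _ h =>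
      absurd (measure_mono_null Set.sdiff_subset hv0) h⟩
  have hvp : 0 < (volume L).toReal := ENNReal.toReal_pos hv0 hv
  have haI' : (a : ℝ) < (simplexIntegral L).toReal := by
    simpa using (ENNReal.toReal_lt_toReal ENNReal.coe_ne_top hI).2 haI
  have hcont : Continuous fun y => volume L * coneIntegral L y :=
    (ENNReal.continuous_const_mul hv).comp (continuous_coneIntegral hL)
  have hU1 := hcont.continuousAt.eventually (gt_mem_nhds ha)
  set r : ℝ := ((simplexIntegral L).toReal - a) * (volume L).toReal / ((m + 2 : ℕ) * (a + 1))
    with hr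
  have hr0 : 0 < r := by
    have := sub_pos.2 haI'
    positivity
  obtain ⟨V, hV, hVo, hVr⟩ := Set.exists_isOpen_lt_of_lt ({0} : Set (Pt m)) (ENNReal.ofReal r)
    (μ := volume) (by
      have : volume ({0} : Set (Pt m)) = 0 :=
        measure_mono_null (fun x hx => by simp_all) volume_height_eq_zero
      rw [this]; exact ENNReal.ofReal_pos.2 hr0)
  refine ⟨_, Filter.inter_mem hU1 (hVo.mem_nhds (hV rfl)), fun K hKL hK hsub hc0 => ?_⟩
  have hcv : volume (L \ K) ≤ volume L := measure_mono Set.sdiff_subset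
  have hc : volume (L \ K) ≠ ⊤ := ne_top_of_le_ne_top hv hcv
  have hK' : volume K ≠ ⊤ := ne_top_of_le_ne_top hv (measure_mono hKL)
  have hIK : simplexIntegral K ≠ ⊤ :=
    ne_top_of_le_ne_top hI (lintegral_mono_set (Set.pi_mono fun _ _ => hKL))
  have hcr : (volume (L \ K)).toReal < r := by
    rw [← ENNReal.toReal_ofReal hr0.le]
    exact (ENNReal.toReal_lt_toReal hc ENNReal.ofReal_ne_top).2
      ((measure_mono fun x hx => (hsub hx).2).trans_lt hVr)
  have hcp : 0 < (volume (L \ K)).toReal := ENNReal.toReal_pos hc0 hc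
  have hsum : (volume K).toReal = (volume L).toReal - (volume (L \ K)).toReal := by
    have h := measure_inter_add_sdiff L hK (μ := volume)
    rw [Set.inter_eq_self_of_subset_right hKL] at h
    rw [← h, ENNReal.toReal_add hK' hc]
    ring
  have h_integral : volume L * ∫⁻ y in L \ K, coneIntegral L y ≤ a * volume (L \ K) := by
    rw [← lintegral_const_mul' _ _ hv, ← setLIntegral_const]
    exact setLIntegral_mono' (hL.measurableSet.diff hK) fun y hy => le_of_lt (hsub hy).1
  have hmain : volume L * simplexIntegral L ≤
      volume L * simplexIntegral K + (m + 2 : ℕ) * (a * volume (L \ K)) := by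
    calc volume L * simplexIntegral L ≤ volume L * (simplexIntegral K +
          (m + 2 : ℕ) * ∫⁻ y in L \ K, coneIntegral L y) := by
          gcongr; exact simplexIntegral_le_add L K
      _ = volume L * simplexIntegral K +
          (m + 2 : ℕ) * (volume L * ∫⁻ y in L \ K, coneIntegral L y) := by ring
      _ ≤ _ := by gcongr
  have hreal := (ENNReal.toReal_le_toReal (ENNReal.mul_ne_top hv hI) (ENNReal.add_ne_top.2
    ⟨ENNReal.mul_ne_top hv hIK, ENNReal.mul_ne_top (ENNReal.natCast_ne_top _)
      (ENNReal.mul_ne_top ENNReal.coe_ne_top hc)⟩)).2 hmain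
  rw [ENNReal.toReal_add (ENNReal.mul_ne_top hv hIK) (ENNReal.mul_ne_top
    (ENNReal.natCast_ne_top _) (ENNReal.mul_ne_top ENNReal.coe_ne_top hc))] at hreal
  simp only [ENNReal.toReal_mul, ENNReal.toReal_natCast, ENNReal.coe_toReal] at hreal
  have hcv' := (ENNReal.toReal_le_toReal hc hv).2 hcv
  rw [hsum]
  set v := (volume L).toReal
  set c := (volume (L \ K)).toReal
  set I := (simplexIntegral L).toReal
  set J := (simplexIntegral K).toReal
  have key := mul_one_sub_pow_lt (n := m + 2) (I := I) (J := J) (a := a) (x := c / v) (by simp)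
    (by positivity) ((div_le_one hvp).2 hcv') a.2 ?_ ?_
  · have : (v - c) ^ (m + 2) = (1 - c / v) ^ (m + 2) * v ^ (m + 2) := by
      rw [← mul_pow]; congr 1; field_simp
    rw [this, ← mul_assoc]
    exact mul_lt_mul_of_pos_right key (by positivity)
  · refine le_of_mul_le_mul_left (hreal.trans_eq ?_) hvp
    field_simp
  · rw [hr, lt_div_iff₀ (by positivity)] at hcr
    have ha0 : (0 : ℝ) ≤ a := a.2
    have : ((m + 2 : ℕ) : ℝ) * (c / v) * a = c * ((m + 2 : ℕ) * a) / v := by ring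
    rw [this, div_lt_iff₀ hvp]
    have : 0 < c * ((m + 2 : ℕ) : ℝ) := by positivity
    nlinarith

/-- A set `K ⊆ L` obtained by truncating a convex cone near its apex has larger normalized
integral. -/
lemma exists_convex_pair (hm : 3 ≤ m) : ∃ K L : Set (Pt m),
    (IsCompact K ∧ Convex ℝ K ∧ (interior K).Nonempty) ∧
    (IsCompact L ∧ Convex ℝ L ∧ (interior L).Nonempty) ∧ K ⊆ L ∧
      (simplexIntegral L).toReal * (volume K).toReal ^ (m + 2) <
        (simplexIntegral K).toReal * (volume L).toReal ^ (m + 2) := by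
  obtain ⟨η, hη, hlt⟩ := exists_ballCone hm
  obtain ⟨U, hU, h⟩ := exists_nhds_cut (isCompact_ballCone η) hlt
  obtain ⟨ε, hε, hεU⟩ := Metric.mem_nhds_iff.1 hU
  obtain ⟨δ, hδ0, hδ⟩ := exists_between (lt_min (lt_min hε (mul_pos hε hη)) (one_half_pos (α := ℝ)))
  rw [lt_min_iff, lt_min_iff] at hδ
  have hcl : IsClosed {x : Pt m | δ ≤ x.1} := isClosed_le continuous_const continuous_fst
  set K := ballCone m η ∩ {x | δ ≤ x.1} with hK
  have hKL : K ⊆ ballCone m η := Set.inter_subset_left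
  have hopen (s : Set ℝ) (hs : IsOpen s) : IsOpen
      {x : Pt m | x.1 ^ 2 + x.2 ⬝ᵥ x.2 < 1 ∧ η * ‖x.2‖ < x.1 ∧ x.1 ∈ s} := by
    unfold dotProduct
    have h1 : IsOpen {x : Pt m | x.1 ^ 2 + ∑ i, x.2 i * x.2 i < 1} :=
      isOpen_lt (by fun_prop) continuous_const
    have h2 : IsOpen {x : Pt m | η * ‖x.2‖ < x.1} := isOpen_lt (by fun_prop) (by fun_prop)
    exact h1.inter (h2.inter (hs.preimage continuous_fst))
  have h_integral : (interior K).Nonempty := by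
    refine ⟨(1 / 2, 0), mem_interior.2 ⟨_, ?_, hopen (Set.Ioi δ) isOpen_Ioi, ?_⟩⟩
    · exact fun x hx => ⟨⟨hx.1.le, hx.2.1.le⟩, (Set.mem_Ioi.1 hx.2.2).le⟩
    · refine ⟨by norm_num, by norm_num, hδ.2⟩
  refine ⟨K, ballCone m η, ⟨(isCompact_ballCone η).inter_right hcl, (convex_ballCone hη.le).inter
    ?_, h_integral⟩, ⟨isCompact_ballCone η, convex_ballCone hη.le, h_integral.mono (interior_mono hKL)⟩, hKL,
    h K hKL ((isClosed_ballCone η).inter hcl).measurableSet (fun x hx => hεU ?_) ?_⟩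
  · exact convex_halfSpace_ge (LinearMap.fst ℝ ℝ (Fin m → ℝ)).isLinear δ
  · have h1 : η * ‖x.2‖ ≤ x.1 := hx.1.2
    have h2 : x.1 < δ := not_le.1 fun h' => hx.2 ⟨hx.1, h'⟩
    have h3 : 0 ≤ x.1 := (mul_nonneg hη.le (norm_nonneg _)).trans h1
    rw [mem_ball_zero_iff, Prod.norm_def, max_lt_iff, Real.norm_eq_abs, abs_of_nonneg h3]
    exact ⟨h2.trans hδ.1.1, by nlinarith⟩
  · refine (((hopen (Set.Iio δ) isOpen_Iio).measure_pos volume ?_).trans_le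
      (measure_mono fun x hx => ?_)).ne'
    · refine ⟨(δ / 2, 0), ?_, by simpa using hδ0, by simpa using hδ0⟩
      change (δ / 2) ^ 2 + (0 : Fin m → ℝ) ⬝ᵥ 0 < 1
      rw [dotProduct_zero]
      nlinarith
    · exact ⟨⟨hx.1.le, hx.2.1.le⟩, fun h' => not_lt.2 (show δ ≤ x.1 from h'.2) hx.2.2⟩

/-- Splitting off the first coordinate of a vector in Euclidean space. -/
def splitFirst (m : ℕ) : EuclideanSpace ℝ (Fin (m + 1)) ≃ₜ Pt m where
  toFun x := (x 0, fun i => x i.succ)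
  invFun p := WithLp.toLp 2 (Fin.cons p.1 p.2)
  left_inv x := by
    ext i
    refine Fin.cases ?_ (fun i => ?_) i <;> simp
  right_inv p := by simp
  continuous_toFun := by fun_prop
  continuous_invFun := (PiLp.continuous_toLp 2 _).comp continuous_cons

lemma cons_splitFirst (x : EuclideanSpace ℝ (Fin (m + 1))) :
    (Fin.cons (splitFirst m x).1 (splitFirst m x).2 : Fin (m + 1) → ℝ) = x.ofLp :=
  congrArg WithLp.ofLp ((splitFirst m).left_inv x)

lemma measurePreserving_splitFirst : MeasurePreserving (splitFirst m) :=
  (measurePreserving_vecEquiv m).comp (PiLp.volume_preserving_ofLp (Fin (m + 1)))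

lemma isConvexBody_preimage {A : Set (Pt m)}
    (hA : IsCompact A ∧ Convex ℝ A ∧ (interior A).Nonempty) :
    IsConvexBody (splitFirst m ⁻¹' A) := by
  obtain ⟨h1, h2, h3⟩ := hA
  refine ⟨(splitFirst m).isCompact_preimage.2 h1, h2.is_linear_preimage ⟨?_, ?_⟩, ?_⟩
  · intro x y; rfl
  · intro c x; rfl
  · rw [← (splitFirst m).preimage_interior]
    exact h3.preimage (splitFirst m).surjective

lemma exists_expVolSimplex_eq (m : ℕ) : ∃ c : ℝ, 0 < c ∧ ∀ A : Set (Pt m), MeasurableSet A →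
    expVolSimplex (m + 1) (splitFirst m ⁻¹' A) =
      c * ((simplexIntegral A).toReal / (volume A).toReal ^ (m + 2)) := by
  obtain ⟨c, hc0, hc, hX⟩ := exists_volume_convexHull (m + 1)
  refine ⟨c.toReal, ENNReal.toReal_pos hc0 hc, fun A hA => ?_⟩
  have hmp := volume_preserving_pi (ι := Fin (m + 2)) fun _ => measurePreserving_splitFirst (m := m)
  have hdet (X : Fin (m + 2) → EuclideanSpace ℝ (Fin (m + 1))) :
      affDet (fun i => (X i).ofLp) = simplexDet fun i => splitFirst m (X i) := by
    simp only [← cons_splitFirst]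
    rfl
  have hF : Measurable fun X : Fin (m + 2) → Pt m => ENNReal.ofReal |simplexDet X| :=
    continuous_simplexDet.abs.measurable.ennreal_ofReal
  have hvol : volume (powSet (m + 2) (splitFirst m ⁻¹' A)) = volume A ^ (m + 2) := by
    rw [volume_pi_pi, measurePreserving_splitFirst.measure_preimage hA.nullMeasurableSet,
      Finset.prod_const, Finset.card_univ, Fintype.card_fin]
  have h_integral : ∫⁻ X in powSet (m + 2) (splitFirst m ⁻¹' A), volume (convexHull ℝ (Set.range X)) =
      c * simplexIntegral A := by
    simp only [hX, hdet]
    rw [lintegral_const_mul' _ _ hc, simplexIntegral,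
      ← hmp.setLIntegral_comp_preimage (powSet_measurableSet hA) hF]
    rfl
  rw [expVolSimplex, setAverage_eq, integral_toReal, h_integral, measureReal_def, hvol,
    ENNReal.toReal_mul, ENNReal.toReal_pow, smul_eq_mul]
  · ring
  · simp only [hX, hdet]
    exact ((hF.comp hmp.measurable).const_mul c).aemeasurable
  · refine Filter.Eventually.of_forall fun X => ?_
    rw [hX]
    exact ENNReal.mul_lt_top hc.lt_top ENNReal.ofReal_lt_top

lemma exists_isConvexBody_pair (d : ℕ) (hd : 4 ≤ d) :
    ∃ K L : Set (EuclideanSpace ℝ (Fin d)),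
      IsConvexBody K ∧ IsConvexBody L ∧ K ⊆ L ∧
      expVolSimplex d K > expVolSimplex d L := by
  obtain ⟨m, rfl⟩ : ∃ m, d = m + 1 := ⟨d - 1, by lia⟩
  obtain ⟨K, L, hK, hL, hKL, hlt⟩ := exists_convex_pair (m := m) (by lia)
  obtain ⟨c, hc, h⟩ := exists_expVolSimplex_eq m
  have hpos {A : Set (Pt m)} (hA : IsCompact A ∧ Convex ℝ A ∧ (interior A).Nonempty) :
      0 < (volume A).toReal ^ (m + 2) :=
    pow_pos (ENNReal.toReal_pos (Measure.measure_pos_of_nonempty_interior volume hA.2.2).ne'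
      hA.1.measure_lt_top.ne) _
  refine ⟨splitFirst m ⁻¹' K, splitFirst m ⁻¹' L, isConvexBody_preimage hK,
    isConvexBody_preimage hL, Set.preimage_mono hKL, ?_⟩
  rw [h K hK.1.measurableSet, h L hL.1.measurableSet, gt_iff_lt]
  refine mul_lt_mul_of_pos_left ?_ hc
  rwa [div_lt_div_iff₀ (hpos hL) (hpos hK)]

end SimplexVolume

/-- For every `d ≥ 4` there are convex bodies `K ⊆ L` in `ℝ^d` with
`E(V_K) > E(V_L)`. -/
theorem expVolSimplex_not_monotone_high_dim
    (d : ℕ) (hd : 4 ≤ d) :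
    ∃ K L : Set (EuclideanSpace ℝ (Fin d)),
      IsConvexBody K ∧ IsConvexBody L ∧ K ⊆ L ∧
      expVolSimplex d K > expVolSimplex d L :=
  SimplexVolume.exists_isConvexBody_pair d hd
end

section
/- Let d = 2 or d = 3. Then there exist an integer k_0 ≥ 1 and convex bodies K ⊆ L ⊆ ℝ^d such that for every integer k ≥ k_0 one has E(V_K^k) > E(V_L^k). -/
open MeasureTheory

/-- `E(V_K^k)`: the `k`-th moment of the volume of the convex hull of `d+1`
independent uniformly random points in `K`. -/
noncomputable def momentVolSimplex (d k : ℕ) (K : Set (EuclideanSpace ℝ (Fin d))) : ℝ :=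
  ⨍ X : Fin (d + 1) → EuclideanSpace ℝ (Fin d) in Set.univ.pi (fun _ => K),
    (volume (convexHull ℝ (Set.range X))).toReal ^ k

lemma exists_forall_setAverage_pow_lt {α : Type*} [MeasurableSpace α] {μ : Measure α}
    {A B : Set α} {g : α → ℝ} {m m' : ℝ} (hA : MeasurableSet A) (hB : MeasurableSet B)
    (hAB : A ⊆ B) (hBtop : μ B ≠ ⊤) (hdiff : μ (B \ A) ≠ 0)
    (hg : Measurable g) (hint : ∀ k : ℕ, IntegrableOn (fun x => g x ^ k) B μ)
    (hg0 : ∀ x, 0 ≤ g x) (hm : 0 ≤ m) (hmm' : m < m')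
    (hgm : ∀ x ∈ B \ A, g x ≤ m) (hpos : μ (A ∩ {x | m' ≤ g x}) ≠ 0) :
    ∃ k₀ : ℕ, 1 ≤ k₀ ∧ ∀ k, k₀ ≤ k → ⨍ x in B, g x ^ k ∂μ < ⨍ x in A, g x ^ k ∂μ := by
  set S := A ∩ {x | m' ≤ g x} with hS
  have hSm : MeasurableSet S := hA.inter (measurableSet_le measurable_const hg)
  have hAtop : μ A ≠ ⊤ := measure_ne_top_of_subset hAB hBtop
  have hStop : μ S ≠ ⊤ := measure_ne_top_of_subset Set.inter_subset_left hAtop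
  have hDtop : μ (B \ A) ≠ ⊤ := measure_ne_top_of_subset Set.sdiff_subset hBtop
  have hs : 0 < μ.real S := ENNReal.toReal_pos hpos hStop
  have ha : 0 < μ.real A := hs.trans_le (measureReal_mono Set.inter_subset_left hAtop)
  have hd : 0 < μ.real (B \ A) := ENNReal.toReal_pos hdiff hDtop
  have hb : μ.real B = μ.real A + μ.real (B \ A) := by
    rw [measureReal_sdiff hAB hA]; ring
  have hm' : 0 < m' := hm.trans_lt hmm'
  have hlim := tendsto_pow_atTop_nhds_zero_of_lt_one (div_nonneg hm hm'.le)
    ((div_lt_one hm').2 hmm')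
  obtain ⟨k₁, hk₁⟩ := Filter.eventually_atTop.1
    (hlim.eventually (gt_mem_nhds (div_pos hs ha)))
  refine ⟨max 1 k₁, le_max_left _ _, fun k hk => ?_⟩
  have hsmall : μ.real A * m ^ k < μ.real S * m' ^ k := by
    have := hk₁ k ((le_max_right _ _).trans hk)
    rw [div_pow, div_lt_div_iff₀ (pow_pos hm' k) ha] at this
    linarith
  have hI : μ.real S * m' ^ k ≤ ∫ x in A, g x ^ k ∂μ := calc
    μ.real S * m' ^ k = ∫ _ in S, m' ^ k ∂μ := by simp
    _ ≤ ∫ x in S, g x ^ k ∂μ := by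
      refine setIntegral_mono_on (integrableOn_const hStop)
        ((hint k).mono_set (Set.inter_subset_left.trans hAB)) hSm fun x hx => ?_
      exact pow_le_pow_left₀ hm'.le hx.2 k
    _ ≤ ∫ x in A, g x ^ k ∂μ :=
      setIntegral_mono_set ((hint k).mono_set hAB)
        (Filter.Eventually.of_forall fun x => pow_nonneg (hg0 x) k)
        (Filter.Eventually.of_forall fun _ hx => hx.1)
  have hJ : ∫ x in B \ A, g x ^ k ∂μ ≤ μ.real (B \ A) * m ^ k := calc
    ∫ x in B \ A, g x ^ k ∂μ ≤ ∫ _ in B \ A, m ^ k ∂μ :=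
      setIntegral_mono_on ((hint k).mono_set Set.sdiff_subset) (integrableOn_const hDtop)
        (hB.diff hA) fun x hx => pow_le_pow_left₀ (hg0 x) (hgm x hx) k
    _ = μ.real (B \ A) * m ^ k := by simp
  have hsplit : ∫ x in B, g x ^ k ∂μ = ∫ x in A, g x ^ k ∂μ + ∫ x in B \ A, g x ^ k ∂μ := by
    rw [setIntegral_sdiff hA (hint k) hAB]; ring
  rw [setAverage_eq, setAverage_eq, smul_eq_mul, smul_eq_mul, hsplit, hb, inv_mul_eq_div,
    inv_mul_eq_div, div_lt_div_iff₀ (by positivity) ha]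
  have := mul_lt_mul_of_pos_left (hsmall.trans_le hI) hd
  have := mul_le_mul_of_nonneg_left hJ ha.le
  linarith

section Determinant

variable {ι : Type*} [Fintype ι] [DecidableEq ι]

/-- The unit vectors, together with one further vector `v`, as a family indexed by `Option ι`. -/
def unitVectorsWith (v : ι → ℝ) : Option ι → ι → ℝ
  | none => v
  | some j => Pi.single j 1

lemma abs_det_unitVectors_of_injective {σ : ι → ι} (hσ : Function.Injective σ) :
    |Matrix.det (Matrix.of fun i => (Pi.single (σ i) 1 : ι → ℝ))| = 1 := by
  have h : Matrix.of (fun i => (Pi.single (σ i) 1 : ι → ℝ)) =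
      (1 : Matrix ι ι ℝ).submatrix
        (Equiv.ofBijective σ (Finite.injective_iff_bijective.1 hσ)) id := by
    ext i j
    simp [Matrix.one_apply, Pi.single_apply, eq_comm]
  rw [h, Matrix.det_permute, Matrix.det_one, mul_one]
  rcases Int.units_eq_one_or
    (Equiv.Perm.sign (Equiv.ofBijective σ (Finite.injective_iff_bijective.1 hσ))) with h | h <;>
    simp [h]

lemma abs_det_unitVectorsWith_le {v : ι → ℝ} {q : ℝ} (hq : 0 ≤ q) (hv : ∀ j, |v j| ≤ q)
    {f : ι → Option ι} {i : ι} (hi : f i = none) :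
    |Matrix.det (Matrix.of fun l => unitVectorsWith v (f l))| ≤ q := by
  by_cases hf : Function.Injective f
  swap
  · obtain ⟨a, b, hab, hne⟩ : ∃ a b, f a = f b ∧ a ≠ b := by
      simpa [Function.Injective] using hf
    rw [Matrix.det_zero_of_row_eq hne (by ext; simp [hab])]
    simpa using hq
  obtain ⟨a, ha⟩ : ∃ a, ∀ l, f l ≠ a := by
    by_contra! h
    have := Fintype.card_le_of_surjective f h
    simp at this
  obtain ⟨j, rfl⟩ : ∃ j, a = some j := by
    cases a with
    | none => exact absurd hi (ha i)
    | some j => exact ⟨j, rfl⟩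
  have hsurj : ∀ j', j' ≠ j → ∃ l, f l = some j' := by
    intro j' hj'
    let g : Option ι → Option ι := fun o => o.elim (some j) f
    have hg : Function.Injective g := by
      rintro (_ | x) (_ | y) hxy
      · rfl
      · exact absurd hxy.symm (ha y)
      · exact absurd hxy (ha x)
      · exact congrArg some (hf hxy)
    obtain ⟨_ | l, hl⟩ := Finite.injective_iff_surjective.1 hg (some j')
    · exact absurd (Option.some_injective _ hl).symm hj'
    · exact ⟨l, hl⟩
  set N : Matrix ι ι ℝ := Matrix.of fun l => unitVectorsWith v (f l) with hN
  have hNv : N = N.updateRow i (∑ j', v j' • Pi.single j' 1) := by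
    have : N i = ∑ j', v j' • (Pi.single j' 1 : ι → ℝ) := by
      rw [← pi_eq_sum_univ']
      ext s
      simp [hN, hi, unitVectorsWith]
    rw [← this, Matrix.updateRow_eq_self]
  have hdet : N.det = v j * (N.updateRow i (Pi.single j 1)).det := by
    have hlin : ∀ u, (N.updateRow i u).det =
        (Matrix.detRowAlternating (R := ℝ) (n := ι)).toMultilinearMap.toLinearMap N i u :=
      fun _ => rfl
    conv_lhs => rw [hNv, hlin, map_sum]
    rw [Finset.sum_eq_single j _ (by simp), map_smul, ← hlin, smul_eq_mul]
    intro j' _ hj'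
    obtain ⟨l, hl⟩ := hsurj j' hj'
    have hli : l ≠ i := by
      rintro rfl
      simp [hi] at hl
    rw [map_smul, ← hlin, Matrix.det_zero_of_row_eq hli, smul_zero]
    ext s
    simp [hli, hN, hl, unitVectorsWith]
  have hone : |(N.updateRow i (Pi.single j 1)).det| = 1 := by
    have hsome : ∀ l, ∃ s, Function.update f i (some j) l = some s := by
      intro l
      by_cases hl : l = i
      · exact ⟨j, by simp [hl]⟩
      · have : f l ≠ none := fun h => hl (hf (h.trans hi.symm))
        simpa [hl] using Option.ne_none_iff_exists'.1 this
    choose σ hσ using hsome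
    have hσinj : Function.Injective σ := by
      intro x y hxy
      have hxy' : Function.update f i (some j) x = Function.update f i (some j) y := by
        rw [hσ, hσ, hxy]
      by_cases hx : x = i <;> by_cases hy : y = i
      · rw [hx, hy]
      · exact absurd (by simpa [hx, hy] using hxy'.symm) (ha y)
      · exact absurd (by simpa [hx, hy] using hxy') (ha x)
      · exact hf (by simpa [hx, hy] using hxy')
    suffices h : N.updateRow i (Pi.single j 1) = Matrix.of fun l => Pi.single (σ l) 1 by
      rw [h, abs_det_unitVectors_of_injective hσinj]
    ext l s
    have hl := hσ l
    by_cases h : l = i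
    · subst h
      simp at hl
      simp [hl]
    · simp [h] at hl
      simp [h, hN, hl, unitVectorsWith]
  rw [hdet, abs_mul, hone, mul_one]
  exact hv j

lemma abs_det_unitVectorsWith_le_one {v : ι → ℝ} (hv : ∀ j, |v j| ≤ 1) (f : ι → Option ι) :
    |Matrix.det (Matrix.of fun l => unitVectorsWith v (f l))| ≤ 1 := by
  by_cases h : ∃ i, f i = none
  · obtain ⟨i, hi⟩ := h
    exact abs_det_unitVectorsWith_le zero_le_one hv hi
  push Not at h
  choose σ hσ using fun l => Option.ne_none_iff_exists'.1 (h l)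
  by_cases hinj : Function.Injective σ
  · simpa [hσ, unitVectorsWith] using (abs_det_unitVectors_of_injective hinj).le
  · obtain ⟨a, b, hab, hne⟩ : ∃ a b, σ a = σ b ∧ a ≠ b := by
      simpa [Function.Injective] using hinj
    rw [Matrix.det_zero_of_row_eq hne (by ext; simp [hσ, hab])]
    simp

lemma abs_det_convexCombination_le {v : ι → ℝ} {q : ℝ} (hq : 0 ≤ q) (hq1 : q ≤ 1)
    (hv : ∀ j, |v j| ≤ q) {w : ι → Option ι → ℝ} (hw : ∀ i, w i ∈ stdSimplex ℝ (Option ι))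
    (i : ι) :
    |Matrix.det (Matrix.of fun l j => w l (some j) + w l none * v j)| ≤ 1 - (1 - q) * w i none := by
  have hrow : Matrix.of (fun l j => w l (some j) + w l none * v j) =
      Matrix.of fun l => ∑ a, w l a • unitVectorsWith v a := by
    ext l j
    simp [Fintype.sum_option, unitVectorsWith, Pi.single_apply, add_comm]
  let r : ι → Option ι → ℝ := fun l a => if l = i ∧ a = none then q else 1
  have hbound : ∀ f : ι → Option ι,
      |Matrix.det (Matrix.of fun l => unitVectorsWith v (f l))| ≤ ∏ l, r l (f l) := by
    intro f
    rw [Finset.prod_eq_single i (fun l _ hl => by simp [r, hl]) (by simp)]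
    by_cases hi : f i = none
    · simpa [r, hi] using abs_det_unitVectorsWith_le hq hv hi
    · simpa [r, hi] using abs_det_unitVectorsWith_le_one (fun j => (hv j).trans hq1) f
  have hexpand : Matrix.det (Matrix.of fun l => ∑ a, w l a • unitVectorsWith v a) =
      ∑ f : ι → Option ι, (∏ l, w l (f l)) *
        Matrix.det (Matrix.of fun l => unitVectorsWith v (f l)) := by
    have := (Matrix.detRowAlternating (R := ℝ) (n := ι)).toMultilinearMap.map_sum
      (fun l a => w l a • unitVectorsWith v a)
    refine this.trans (Finset.sum_congr rfl fun f _ => ?_)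
    exact (Matrix.detRowAlternating (R := ℝ) (n := ι)).toMultilinearMap.map_smul_univ _ _
  rw [hrow, hexpand]
  calc _ ≤ ∑ f : ι → Option ι, ∏ l, w l (f l) * r l (f l) := by
        refine (Finset.abs_sum_le_sum_abs _ _).trans (Finset.sum_le_sum fun f _ => ?_)
        have h0 : 0 ≤ ∏ l, w l (f l) := Finset.prod_nonneg fun l _ => (hw l).1 _
        rw [abs_mul, abs_of_nonneg h0, Finset.prod_mul_distrib]
        exact mul_le_mul_of_nonneg_left (hbound f) h0
    _ = ∏ l, ∑ a, w l a * r l a := by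
        rw [Finset.prod_univ_sum, Fintype.piFinset_univ]
    _ = 1 - (1 - q) * w i none := by
        rw [Finset.prod_eq_single i (fun l _ hl => by simp [r, hl, (hw l).2]) (by simp)]
        have := (hw i).2
        simp [Fintype.sum_option, r] at this ⊢
        linarith

end Determinant

section Simplex

variable {d : ℕ}

/-- The matrix whose rows are the barycentric coordinates of the points `X i` with respect to
the simplex spanned by the origin and the standard basis. -/
def baryMatrix (X : Fin (d + 1) → EuclideanSpace ℝ (Fin d)) :
    Matrix (Fin (d + 1)) (Fin (d + 1)) ℝ :=
  Matrix.of fun i => Fin.cons (1 - ∑ j, X i j) (fun j => X i j)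

lemma det_baryMatrix (X : Fin (d + 1) → EuclideanSpace ℝ (Fin d)) :
    (baryMatrix X).det = (Matrix.of fun i j : Fin d => X i.succ j - X 0 j).det := by
  let N : Matrix (Fin (d + 1)) (Fin (d + 1)) ℝ :=
    Matrix.of fun i => Fin.cons 1 (fun j => X i j)
  let N' : Matrix (Fin (d + 1)) (Fin (d + 1)) ℝ :=
    Matrix.of (Fin.cons (Fin.cons 1 (fun j => X 0 j))
      fun i => Fin.cons 0 fun j => X i.succ j - X 0 j)
  have hcol : (baryMatrix X).det = N.det := by
    have := Matrix.det_updateCol_sum N 0 (Fin.cons 1 fun _ => -1)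
    rw [Fin.cons_zero, one_smul] at this
    rw [← this]
    congr 1
    ext i j
    refine Fin.cases ?_ (fun j => ?_) j
    · simp [baryMatrix, N, Fin.sum_univ_succ, sub_eq_add_neg]
    · simp [baryMatrix, N]
  have hrow : N.det = N'.det := by
    refine Matrix.det_eq_of_forall_row_eq_smul_add_const (Fin.cons 0 fun _ => 1) 0 (by simp) ?_
    intro i j
    refine Fin.cases ?_ (fun i => ?_) i <;> refine Fin.cases ?_ (fun j => ?_) j <;>
      simp [N, N']
  rw [hcol, hrow, Matrix.det_succ_column_zero, Fin.sum_univ_succ]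
  simp only [N', Matrix.of_apply, Fin.cons_zero, Fin.cons_succ]
  simp
  rfl

lemma continuous_det_baryMatrix :
    Continuous fun X : Fin (d + 1) → EuclideanSpace ℝ (Fin d) => (baryMatrix X).det := by
  refine Continuous.matrix_det (continuous_matrix fun i j => ?_)
  refine Fin.cases ?_ (fun j => ?_) j <;> simp only [baryMatrix, Matrix.of_apply, Fin.cons_zero,
    Fin.cons_succ] <;> fun_prop

/-- The origin followed by the standard basis vectors. -/
noncomputable def stdVertex : Fin (d + 1) → EuclideanSpace ℝ (Fin d) :=
  Fin.cons 0 fun j => EuclideanSpace.single j 1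

lemma det_baryMatrix_stdVertex : (baryMatrix (stdVertex (d := d))).det = 1 := by
  rw [det_baryMatrix]
  convert Matrix.det_one (n := Fin d) (R := ℝ)
  ext i j
  simp [stdVertex, Matrix.one_apply, eq_comm]

lemma volume_convexHull_range (X : Fin (d + 1) → EuclideanSpace ℝ (Fin d)) :
    (volume (convexHull ℝ (Set.range X))).toReal =
      |(baryMatrix X).det| *
        (volume (convexHull ℝ (Set.range (stdVertex (d := d))))).toReal := by
  let b := (EuclideanSpace.basisFun (Fin d) ℝ).toBasis
  let B : Matrix (Fin d) (Fin d) ℝ := Matrix.of fun i j => X j.succ i - X 0 i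
  let A : EuclideanSpace ℝ (Fin d) →ₗ[ℝ] EuclideanSpace ℝ (Fin d) := Matrix.toLin b b B
  have hA : ∀ j, A (EuclideanSpace.single j 1) = X j.succ - X 0 := by
    intro j
    have h1 : (EuclideanSpace.single j 1 : EuclideanSpace ℝ (Fin d)) = b j := by simp [b]
    rw [h1, Matrix.toLin_self]
    ext i
    simp [b, B, Pi.single_apply]
  have hrange : Set.range X = (fun y => X 0 + y) '' (A '' Set.range stdVertex) := by
    rw [← Set.range_comp, ← Set.range_comp]
    congr 1
    ext1 i
    refine Fin.cases ?_ (fun j => ?_) i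
    · simp [stdVertex]
    · simp [stdVertex, hA]
  have himage : convexHull ℝ (Set.range X) =
      (fun y => X 0 + y) '' (A '' convexHull ℝ (Set.range stdVertex)) := by
    rw [hrange, LinearMap.image_convexHull]
    exact convexHull_vadd (𝕜 := ℝ) (X 0) (A '' Set.range stdVertex)
  have hdet : LinearMap.det A = (baryMatrix X).det := by
    rw [det_baryMatrix, ← Matrix.det_transpose, LinearMap.det_toLin]
    rfl
  rw [himage, Set.image_add_left, measure_preimage_add, Measure.addHaar_image_linearMap, hdet,
    ENNReal.toReal_mul, ENNReal.toReal_ofReal (abs_nonneg _)]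

lemma isOpen_openSimplex :
    IsOpen {y : EuclideanSpace ℝ (Fin d) | (∀ j, 0 < y j) ∧ ∑ j, y j < 1} := by
  have h : {y : EuclideanSpace ℝ (Fin d) | (∀ j, 0 < y j) ∧ ∑ j, y j < 1} =
      (⋂ j, {y : EuclideanSpace ℝ (Fin d) | 0 < y j}) ∩ {y | ∑ j, y j < 1} := by
    ext; simp
  rw [h]
  exact (isOpen_iInter_of_finite fun j => isOpen_lt (by fun_prop) (by fun_prop)).inter
    (isOpen_lt (by fun_prop) (by fun_prop))

lemma nonempty_openSimplex :
    {y : EuclideanSpace ℝ (Fin d) | (∀ j, 0 < y j) ∧ ∑ j, y j < 1}.Nonempty := by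
  refine ⟨WithLp.toLp 2 fun _ => 1 / ((d : ℝ) + 1), fun j => ?_, ?_⟩
  · simp only; positivity
  · have : (0 : ℝ) < d + 1 := by positivity
    simp [mul_inv_lt_iff₀ this]

/-- The linear map sending weights on the vertices of the standard simplex and on the extra
vertex `(3/(2d), …, 3/(2d))` to the corresponding combination of these points. -/
noncomputable def weightMap (d : ℕ) :
    (Option (Fin (d + 1)) → ℝ) →ₗ[ℝ] EuclideanSpace ℝ (Fin d) where
  toFun w := WithLp.toLp 2 fun j => w (some j.succ) + w none * (3 / (2 * d))
  map_add' w w' := by ext; simp; ring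
  map_smul' c w := by ext; simp; ring

lemma weightMap_apply (w : Option (Fin (d + 1)) → ℝ) (j : Fin d) :
    weightMap d w j = w (some j.succ) + w none * (3 / (2 * d)) := rfl

lemma sum_weightMap (hd : 0 < d) {w : Option (Fin (d + 1)) → ℝ} (hw : w ∈ stdSimplex ℝ _) :
    ∑ j, weightMap d w j = 1 - w (some 0) + w none / 2 := by
  have h := hw.2
  rw [Fintype.sum_option, Fin.sum_univ_succ] at h
  have hd' : (d : ℝ) ≠ 0 := by positivity
  simp only [weightMap_apply, Finset.sum_add_distrib, Finset.sum_const, Finset.card_univ,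
    Fintype.card_fin, nsmul_eq_mul]
  have : (d : ℝ) * (w none * (3 / (2 * d))) = 3 / 2 * w none := by field_simp
  linarith

/-- The convex hull of the standard simplex and the extra vertex `(3/(2d), …, 3/(2d))`,
restricted to weight at most `t` on the extra vertex. -/
def extendedSimplex (d : ℕ) (t : ℝ) : Set (EuclideanSpace ℝ (Fin d)) :=
  weightMap d '' (stdSimplex ℝ _ ∩ {w | w none ≤ t})

lemma extendedSimplex_mono {s t : ℝ} (h : s ≤ t) : extendedSimplex d s ⊆ extendedSimplex d t :=
  Set.image_mono fun _ hw => ⟨hw.1, hw.2.trans h⟩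

lemma openSimplex_subset_extendedSimplex {t : ℝ} (ht : 0 ≤ t) :
    {y : EuclideanSpace ℝ (Fin d) | (∀ j, 0 < y j) ∧ ∑ j, y j < 1} ⊆ extendedSimplex d t := by
  rintro y ⟨hy, hsum⟩
  refine ⟨fun o => o.elim 0 (Fin.cons (1 - ∑ j, y j) fun j => y j), ⟨⟨?_, ?_⟩, ht⟩, ?_⟩
  · rintro (_ | i)
    · simp
    · refine Fin.cases ?_ (fun j => ?_) i
      · simpa using hsum.le
      · simpa using (hy j).le
  · simp [Fintype.sum_option, Fin.sum_univ_succ]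
  · ext j
    simp [weightMap_apply]

lemma openSimplex_subset_convexHull :
    {y : EuclideanSpace ℝ (Fin d) | (∀ j, 0 < y j) ∧ ∑ j, y j < 1} ⊆
      convexHull ℝ (Set.range stdVertex) := by
  rintro y ⟨hy, hsum⟩
  have hmem : ∑ i, (Fin.cons (1 - ∑ j, y j) (fun j => y j) : Fin (d + 1) → ℝ) i •
      stdVertex i ∈ convexHull ℝ (Set.range (stdVertex (d := d))) := by
    refine (convex_convexHull ℝ _).sum_mem (fun i _ => ?_) ?_
      fun i _ => subset_convexHull ℝ _ ⟨i, rfl⟩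
    · refine Fin.cases ?_ (fun j => ?_) i
      · simpa using hsum.le
      · simpa using (hy j).le
    · simp [Fin.sum_univ_succ]
  convert hmem
  ext j
  simp [Fin.sum_univ_succ, stdVertex, Pi.single_apply]

lemma volume_stdSimplex_pos :
    0 < (volume (convexHull ℝ (Set.range (stdVertex (d := d))))).toReal := by
  refine ENNReal.toReal_pos ?_ ?_
  · exact ((isOpen_openSimplex.measure_pos volume nonempty_openSimplex).trans_le
      (measure_mono openSimplex_subset_convexHull)).ne'
  · exact (Set.finite_range _).isCompact_convexHull (𝕜 := ℝ) |>.measure_ne_top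

lemma isConvexBody_extendedSimplex {t : ℝ} (ht : 0 ≤ t) :
    IsConvexBody (extendedSimplex d t) := by
  refine ⟨?_, ?_, ?_⟩
  · refine ((isCompact_stdSimplex ℝ _).inter_right ?_).image
      (weightMap d).continuous_of_finiteDimensional
    exact isClosed_le (by fun_prop) continuous_const
  · refine ((convex_stdSimplex ℝ _).inter ?_).linear_image _
    exact convex_halfSpace_le (LinearMap.isLinear (LinearMap.proj (φ := fun _ => ℝ) none)) t
  · exact nonempty_openSimplex.mono
      (interior_maximal (openSimplex_subset_extendedSimplex ht) isOpen_openSimplex)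

lemma stdVertex_mem_extendedSimplex {t : ℝ} (ht : 0 ≤ t) (i : Fin (d + 1)) :
    stdVertex i ∈ extendedSimplex d t := by
  refine ⟨Pi.single (some i) 1, ⟨single_mem_stdSimplex ℝ _, by simpa using ht⟩, ?_⟩
  ext j
  refine Fin.cases ?_ (fun i => ?_) i
  · simp [weightMap_apply, stdVertex]
  · simp [weightMap_apply, stdVertex, Pi.single_apply]

lemma exists_isOpen_subset_diff_extendedSimplex (hd : 0 < d) {t : ℝ} (ht1 : t < 1) :
    ∃ W : Set (EuclideanSpace ℝ (Fin d)), IsOpen W ∧ W.Nonempty ∧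
      W ⊆ extendedSimplex d 1 \ extendedSimplex d t := by
  obtain ⟨-, hconv, hint⟩ := isConvexBody_extendedSimplex (d := d) zero_le_one
  have hopen : IsOpen {y : EuclideanSpace ℝ (Fin d) | 1 + t / 2 < ∑ j, y j} :=
    isOpen_lt continuous_const (by fun_prop)
  refine ⟨interior (extendedSimplex d 1) ∩ {y | 1 + t / 2 < ∑ j, y j},
    isOpen_interior.inter hopen, ?_, ?_⟩
  · have hw : Pi.single none 1 ∈ stdSimplex ℝ (Option (Fin (d + 1))) :=
      single_mem_stdSimplex ℝ _
    have hmem : weightMap d (Pi.single none 1) ∈ extendedSimplex d 1 :=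
      ⟨_, ⟨hw, by simp⟩, rfl⟩
    have hcl : weightMap d (Pi.single none 1) ∈ closure (interior (extendedSimplex d 1)) := by
      rw [hconv.closure_interior_eq_closure_of_nonempty_interior hint]
      exact subset_closure hmem
    rw [Set.inter_comm]
    refine mem_closure_iff.1 hcl _ hopen ?_
    rw [Set.mem_ofPred_eq, sum_weightMap hd hw]
    simp
    linarith
  · rintro y ⟨hy, hy'⟩
    refine ⟨interior_subset hy, ?_⟩
    rintro ⟨w, ⟨hw, hwt⟩, rfl⟩
    rw [Set.mem_ofPred_eq, sum_weightMap hd hw] at hy'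
    have := hw.1 (some 0)
    simp only [Set.mem_ofPred_eq] at hwt
    linarith

lemma abs_det_baryMatrix_le (hd : 2 ≤ d) {t : ℝ} {X : Fin (d + 1) → EuclideanSpace ℝ (Fin d)}
    (hX : ∀ i, X i ∈ extendedSimplex d 1) {i : Fin (d + 1)} (hi : X i ∉ extendedSimplex d t) :
    |(baryMatrix X).det| ≤ 1 - t / 4 := by
  choose w hw hwX using hX
  have hwt : t < w i none := by
    by_contra! h
    exact hi ⟨w i, ⟨(hw i).1, h⟩, hwX i⟩
  have hd' : (2 : ℝ) ≤ d := by exact_mod_cast hd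
  have hmat : baryMatrix X = Matrix.of fun l j => w l (some j) + w l none *
      (Fin.cons (-1 / 2) (fun _ => 3 / (2 * d)) : Fin (d + 1) → ℝ) j := by
    ext l j
    refine Fin.cases ?_ (fun j => ?_) j
    · simp only [baryMatrix, Matrix.of_apply, Fin.cons_zero, ← hwX]
      rw [sum_weightMap (by omega) (hw l).1]
      ring
    · simp only [baryMatrix, Matrix.of_apply, Fin.cons_succ, ← hwX, weightMap_apply]
  rw [hmat]
  refine (abs_det_convexCombination_le (q := 3 / 4) (by norm_num) (by norm_num) ?_
    (fun l => (hw l).1) i).trans (by linarith)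
  intro j
  refine Fin.cases ?_ (fun j => ?_) j
  · norm_num [abs_le]
  · rw [Fin.cons_succ, abs_of_nonneg (by positivity), div_le_div_iff₀ (by positivity) (by norm_num)]
    linarith

end Simplex

lemma exists_momentVolSimplex_lt {d : ℕ} (hd : 2 ≤ d) :
    ∃ k₀ : ℕ, 1 ≤ k₀ ∧ ∀ k, k₀ ≤ k →
      momentVolSimplex d k (extendedSimplex d 1) <
        momentVolSimplex d k (extendedSimplex d (1 / 2)) := by
  set T := (volume (convexHull ℝ (Set.range (stdVertex (d := d))))).toReal with hT
  have hTpos : 0 < T := volume_stdSimplex_pos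
  let E := EuclideanSpace ℝ (Fin d)
  let g : (Fin (d + 1) → E) → ℝ := fun X => (volume (convexHull ℝ (Set.range X))).toReal
  have hg : ∀ X, g X = |(baryMatrix X).det| * T := volume_convexHull_range
  have hgc : Continuous g := by
    rw [funext hg]
    exact continuous_det_baryMatrix.abs.mul continuous_const
  obtain ⟨hKc, hKconv, hKint⟩ := isConvexBody_extendedSimplex (d := d) (t := 1 / 2) (by norm_num)
  obtain ⟨hLc, -, -⟩ := isConvexBody_extendedSimplex (d := d) zero_le_one
  have hSK : IsCompact (Set.univ.pi fun _ : Fin (d + 1) => extendedSimplex d (1 / 2)) :=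
    isCompact_univ_pi fun _ => hKc
  have hSL : IsCompact (Set.univ.pi fun _ : Fin (d + 1) => extendedSimplex d 1) :=
    isCompact_univ_pi fun _ => hLc
  refine exists_forall_setAverage_pow_lt (g := g) (m := 7 / 8 * T) (m' := 15 / 16 * T)
    hSK.measurableSet hSL.measurableSet
    (Set.pi_mono fun _ _ => extendedSimplex_mono (by norm_num)) hSL.measure_ne_top ?_
    hgc.measurable (fun k => (hgc.pow k).continuousOn.integrableOn_compact hSL)
    (fun _ => ENNReal.toReal_nonneg) (by positivity) (by linarith) ?_ ?_
  · obtain ⟨W, hWo, ⟨z, hz⟩, hW⟩ :=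
      exists_isOpen_subset_diff_extendedSimplex (d := d) (by omega) (t := 1 / 2)
        (by norm_num)
    have hpos : 0 < volume (Set.univ.pi fun _ : Fin (d + 1) => W) :=
      (isOpen_set_pi Set.finite_univ fun _ _ => hWo).measure_pos _ ⟨fun _ => z, fun _ _ => hz⟩
    refine (hpos.trans_le (measure_mono fun X hX => ?_)).ne'
    exact ⟨fun i hi => (hW (hX i hi)).1, fun h => (hW (hX 0 trivial)).2 (h 0 trivial)⟩
  · rintro X ⟨hXL, hXK⟩
    simp only [Set.mem_pi, Set.mem_univ, true_imp_iff, not_forall] at hXK hXL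
    obtain ⟨i, hi⟩ := hXK
    rw [hg]
    have := abs_det_baryMatrix_le hd hXL hi
    gcongr
    linarith
  · have hopen : IsOpen {X | 15 / 16 * T < g X} := isOpen_lt continuous_const hgc
    have hcl : (stdVertex : Fin (d + 1) → E) ∈
        closure (Set.univ.pi fun _ => interior (extendedSimplex d (1 / 2))) := by
      rw [closure_pi_set, hKconv.closure_interior_eq_closure_of_nonempty_interior hKint]
      exact fun i _ => subset_closure (stdVertex_mem_extendedSimplex (by norm_num) i)
    have hne := mem_closure_iff.1 hcl _ hopen (by
      rw [Set.mem_ofPred_eq, hg, det_baryMatrix_stdVertex, abs_one]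
      linarith)
    have hpos := (hopen.inter (isOpen_set_pi Set.finite_univ fun _ _ => isOpen_interior)).measure_pos
      (volume : Measure (Fin (d + 1) → E)) hne
    refine (hpos.trans_le (measure_mono fun X hX => ?_)).ne'
    exact ⟨fun i hi => interior_subset (hX.2 i hi), le_of_lt (show 15 / 16 * T < g X from hX.1)⟩

/-- In dimensions 2 and 3, there are convex bodies `K ⊆ L` and an integer
`k₀ ≥ 1` such that `E(V_K^k) > E(V_L^k)` for all `k ≥ k₀`. -/
theorem momentVolSimplex_not_monotone_dim_two_three
    (d : ℕ) (hd : d = 2 ∨ d = 3) :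
    ∃ (k₀ : ℕ), 1 ≤ k₀ ∧
      ∃ K L : Set (EuclideanSpace ℝ (Fin d)),
        IsConvexBody K ∧ IsConvexBody L ∧ K ⊆ L ∧
        ∀ k : ℕ, k₀ ≤ k → momentVolSimplex d k K > momentVolSimplex d k L := by
  obtain ⟨k₀, hk₀, h⟩ := exists_momentVolSimplex_lt (d := d) (by omega)
  exact ⟨k₀, hk₀, extendedSimplex d (1 / 2), extendedSimplex d 1,
    isConvexBody_extendedSimplex (by norm_num), isConvexBody_extendedSimplex zero_le_one,
    extendedSimplex_mono (by norm_num), h⟩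
end
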